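/- Let ℓ ≥ 1 and 0 ≤ m ≤ ℓ. Then the sum over all strict partitions μ ∈ F_1^m(Λ_ℓ) of δ_2(μ^b[1])·S_{μ^b[1]} equals the plethysm p_2 ∘ S_{□(ℓ−m,m)}. -/

import Mathlib

open scoped BigOperators

/-- A partition, represented canonically as the multiset of its (positive) parts. -/
structure Ptn where
  parts : Multiset ℕ
  pos : ∀ x ∈ parts, 0 < x

namespace Ptn

/-- Build a partition from an arbitrary multiset of naturals by discarding zero parts. -/
def of (s : Multiset ℕ) : Ptn :=
  ⟨s.filter (fun x => 0 < x), fun _ hx => (Multiset.mem_filter.mp hx).2⟩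

/-- The empty partition. -/
def empty : Ptn := ⟨0, by simp⟩

/-- The `i`-th largest part (`0`-indexed); `0` if `i` is at least the number of parts. -/
def part (l : Ptn) (i : ℕ) : ℕ :=
  ((l.parts.sort (· ≤ ·)).reverse).getD i 0

/-- The number of (positive) parts. -/
def length (l : Ptn) : ℕ := Multiset.card l.parts

/-- The size `|λ|`, i.e. the number being partitioned. -/
def size (l : Ptn) : ℕ := l.parts.sum

/-- A partition is strict if all its parts are distinct. -/
def Strict (l : Ptn) : Prop := l.parts.Nodup

/-- The conjugate partition. -/
def conj (l : Ptn) : Ptn :=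
  of ((Multiset.range (l.part 0)).map
    (fun j => Multiset.card (l.parts.filter (fun x => j < x))))

end Ptn

/-- The rectangular partition `□(n,m)` with `n` rows of length `m`. -/
def rect (n m : ℕ) : Ptn := Ptn.of (Multiset.replicate n m)

/-- The partition obtained by multiplying every part by `r`. -/
def scaleP (r : ℕ) (l : Ptn) : Ptn := Ptn.of (l.parts.map (fun a => r * a))

/-- Diagram containment: every part of `small` is at most the corresponding part of `big`. -/
def Contains (big small : Ptn) : Prop := ∀ i, small.part i ≤ big.part i

/-- The beta-set (first-column hook lengths) `{λ_i + m - 1 - i : i < m}` of `l`,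
computed with `m` beads (`m` at least the number of parts). -/
def betaSet (l : Ptn) (m : ℕ) : Finset ℕ :=
  (Finset.range m).image (fun i => l.part i + (m - 1 - i))

/-- The partition encoded by a finite set of bead positions: each bead contributes a part
equal to the number of empty positions (holes) below it. -/
def ptnOfBeads (B : Finset ℕ) : Ptn :=
  Ptn.of (B.val.map (fun p => p - (B.filter (fun q => q < p)).card))

/-- Levels of the beads on runner `k` of the `r`-abacus of `l`,
drawn with `r * l.length` beads (a multiple of `r`). -/
def runnerLevels (r : ℕ) (l : Ptn) (k : ℕ) : Finset ℕ :=
  (Finset.range (l.part 0 + r * l.length + 1)).filter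
    (fun s => r * s + k ∈ betaSet l (r * l.length))

/-- The `k`-th component `λ[k]` of the `r`-quotient of `l`. -/
def quotP (r : ℕ) (l : Ptn) (k : ℕ) : Ptn := ptnOfBeads (runnerLevels r l k)

/-- The `r`-core of `l`: push all beads of the `r`-abacus down as far as possible. -/
def coreP (r : ℕ) (l : Ptn) : Ptn :=
  ptnOfBeads ((Finset.range r).biUnion
    (fun k => (Finset.range (runnerLevels r l k).card).image (fun s => r * s + k)))

/-- The key of the bead at position `p` for the `r`-numbering of the beads `B`:
a bead which is the `j`-th lowest bead on runner `k` gets key `r * j + k`. -/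
def rKey (r : ℕ) (B : Finset ℕ) (p : ℕ) : ℕ :=
  r * (B.filter (fun q => q % r = p % r ∧ q < p)).card + p % r

/-- The number of inversions between the natural (increasing-position) numbering of the
beads `B` and the numbering by increasing `key`. -/
def inversions (key : ℕ → ℕ) (B : Finset ℕ) : ℕ :=
  ((B ×ˢ B).filter (fun pq => pq.1 < pq.2 ∧ key pq.2 < key pq.1)).card

/-- Exponent of the `r`-sign `δ_r`. -/
def rSignExp (r : ℕ) (l : Ptn) : ℕ :=
  inversions (rKey r (betaSet l (r * l.length))) (betaSet l (r * l.length))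

/-- The `r`-sign `δ_r(λ) ∈ {±1}`. -/
def rSign (r : ℕ) (l : Ptn) : ℤ := (-1) ^ rSignExp r l

/-- The key of the bead at position `p` for the `3`-bar numbering of the beads `B` of the
`3`-bar abacus: first the beads of runner `0` in increasing order, then the pairs of beads
on runners `2` and `1` paired off by increasing level (runner-`2` bead before
runner-`1` bead), then the remaining unpaired beads in increasing order. -/
def barKey (B : Finset ℕ) (p : ℕ) : ℕ :=
  let n0 := (B.filter (fun q => q % 3 = 0)).card
  let t := min ((B.filter (fun q => q % 3 = 1)).card)
              ((B.filter (fun q => q % 3 = 2)).card)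
  let rk := (B.filter (fun q => q % 3 = p % 3 ∧ q < p)).card
  if p % 3 = 0 then rk
  else if rk < t then (if p % 3 = 2 then n0 + 2 * rk else n0 + 2 * rk + 1)
  else n0 + 2 * t + (rk - t)

/-- Exponent of the `3`-bar sign `δ̄_3`.  The beads of the `3`-bar abacus of a strict
partition sit at the positions given by the parts. -/
def barSignExp (l : Ptn) : ℕ :=
  inversions (barKey l.parts.toFinset) l.parts.toFinset

/-- The `3`-bar sign `δ̄_3(λ) ∈ {±1}` of a strict partition. -/
def barSign3 (l : Ptn) : ℤ := (-1) ^ barSignExp l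

/-- The double `D(λ) = (λ_1,…,λ_l | λ_1 - 1,…,λ_l - 1)` (Frobenius notation)
of a strict partition `λ`, constructed row by row. -/
noncomputable def double (l : Ptn) : Ptn :=
  Ptn.of ((Multiset.range (l.length + l.part 0)).map (fun i =>
    (if i < l.length then l.part i + 1 else 0) +
      ((Finset.range (min i l.length)).filter (fun j => i + 1 ≤ j + l.part j)).card))

/-- The second component `λ^b[1] = D(λ)[1]` of the `3`-bar quotient of a strict
partition `λ`. -/
noncomputable def barQuot1 (l : Ptn) : Ptn := quotP 3 (double l) 1

/-- The staircase-like strict partition `Λ_ℓ = (3ℓ-2, 3ℓ-5, …, 7, 4, 1)`. -/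
def LamP (ℓ : ℕ) : Ptn := Ptn.of ((Multiset.range ℓ).map (fun i => 3 * i + 1))

/-- The staircase partition `Δ_ℓ = (ℓ, ℓ-1, …, 1)`. -/
def DelP (ℓ : ℕ) : Ptn := Ptn.of (Multiset.range (ℓ + 1))

/-- `F_1^m(Λ_ℓ)`: strict partitions obtained from `Λ_ℓ` by adding `m` cells, each
labelled `1`, where the cell in (0-indexed) column `j` is labelled `1` iff `j % 3 = 1`
(each row reads `0,1,0,0,1,0,…`). -/
def F1Lam (ℓ m : ℕ) : Set Ptn :=
  {mu | mu.Strict ∧ Contains mu (LamP ℓ) ∧ mu.size = (LamP ℓ).size + m ∧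
    ∀ i j, (LamP ℓ).part i ≤ j → j < mu.part i → j % 3 = 1}

/-- `F_1^m(Δ_ℓ)`: partitions obtained from `Δ_ℓ` by adding `m` cells, each labelled `1`,
where the cell `(i,j)` is labelled `1` iff `i + j` is odd. -/
def F1Del (ℓ m : ℕ) : Set Ptn :=
  {mu | Contains mu (DelP ℓ) ∧ mu.size = (DelP ℓ).size + m ∧
    ∀ i j, (DelP ℓ).part i ≤ j → j < mu.part i → (i + j) % 2 = 1}

/-- `(α, β)` is complementary relative to the rectangle `□(n,m)`:
`α ⊆ □(n,m)` and `β_i = m - α_{n+1-i}` for `1 ≤ i ≤ n` (0-indexed below). -/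
def Complementary (n m : ℕ) (a b : Ptn) : Prop :=
  a.length ≤ n ∧ a.part 0 ≤ m ∧ b.length ≤ n ∧
    ∀ i < n, b.part i = m - a.part (n - 1 - i)

/-- `W(n,m)`: the set of `(n,m)`-balanced partitions, i.e. partitions of `2nm` with at
most `2n` parts satisfying `μ_i + μ_{2n+1-i} = 2m` for `1 ≤ i ≤ n` (0-indexed below). -/
def W (n m : ℕ) : Set Ptn :=
  {mu | mu.size = 2 * n * m ∧ mu.length ≤ 2 * n ∧
    ∀ i < n, mu.part i + mu.part (2 * n - 1 - i) = 2 * m}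

/-! ### The ring of symmetric functions

We realise the ring of symmetric functions (with rational coefficients) as the
polynomial ring `ℚ[p_1, p_2, …]` in the power sums: the variable `X n` of
`MvPolynomial ℕ ℚ` stands for the power sum `p_{n+1}`. -/

abbrev SymF := MvPolynomial ℕ ℚ

open MvPolynomial

/-- `z_ρ = ∏ a^{m_a} m_a!` for a partition given as a multiset `ρ`. -/
def zval (s : Multiset ℕ) : ℚ :=
  s.toFinset.prod (fun a => (a : ℚ) ^ s.count a * (Nat.factorial (s.count a) : ℚ))

/-- The power sum product `p_ρ` of a multiset `ρ`. -/
noncomputable def pMult (s : Multiset ℕ) : SymF :=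
  (s.map (fun a => (X (a - 1) : SymF))).prod

/-- The complete homogeneous symmetric function `h_n = Σ_{ρ ⊢ n} z_ρ⁻¹ p_ρ`. -/
noncomputable def hSym (n : ℕ) : SymF :=
  ∑ ρ : Nat.Partition n, (zval ρ.parts)⁻¹ • pMult ρ.parts

/-- `h_k` for an integer index, vanishing for negative `k`. -/
noncomputable def hz (k : ℤ) : SymF := if k < 0 then 0 else hSym k.toNat

/-- The Schur function `S_λ`, via the Jacobi–Trudi formula
`S_λ = det(h_{λ_i - i + j})`. -/
noncomputable def schur (l : Ptn) : SymF :=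
  Matrix.det (Matrix.of (fun i j : Fin l.length =>
    hz ((l.part i.val : ℤ) + (j.val : ℤ) - (i.val : ℤ))))

/-- The plethysm `p_r ∘ f`: the algebra endomorphism sending each power sum `p_k`
to `p_{rk}`, i.e. substituting `x_i^r` for each variable `x_i`. -/
noncomputable def pleth (r : ℕ) (f : SymF) : SymF :=
  MvPolynomial.aeval (fun n => (X (r * (n + 1) - 1) : SymF)) f

/-- The `z`-weight of a power-sum monomial (exponent vector `d`). -/
def zfac (d : ℕ →₀ ℕ) : ℚ :=
  d.prod (fun i e => ((i : ℚ) + 1) ^ e * (Nat.factorial e : ℚ))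

/-- The Hall inner product, for which `⟨p_ρ, p_σ⟩ = δ_{ρσ} z_ρ` and the Schur
functions are orthonormal. -/
noncomputable def hall (f g : SymF) : ℚ :=
  f.support.sum (fun d => f.coeff d * g.coeff d * zfac d)

/-- The multi-Littlewood–Richardson coefficient `LR^λ_{μ^0,…,μ^{r-1}}`:
the multiplicity of `S_λ` in `S_{μ^0} ⋯ S_{μ^{r-1}}`. -/
noncomputable def LRmulti (lam : Ptn) (r : ℕ) (q : ℕ → Ptn) : ℚ :=
  hall ((Finset.range r).prod (fun k => schur (q k))) (schur lam)

/-- The Littlewood–Richardson coefficient `LR^λ_{α,β}`: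
the multiplicity of `S_λ` in `S_α · S_β`. -/
noncomputable def LR2 (lam a b : Ptn) : ℚ := hall (schur a * schur b) (schur lam)

/-- The irreducible symmetric group character `χ^μ(ρ)`, via the Frobenius formula
`χ^μ_ρ = ⟨S_μ, p_ρ⟩`. -/
noncomputable def chi (mu rho : Ptn) : ℚ := hall (schur mu) (pMult rho.parts)

/-- Symmetric functions in two alphabets `u`, `v`: `X (inl n)` is `p_{n+1}(u)` and
`X (inr n)` is `p_{n+1}(v)`. -/
abbrev SymF2 := MvPolynomial (ℕ ⊕ ℕ) ℚ

/-- `f ↦ f(u)`. -/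
noncomputable def toU : SymF →ₐ[ℚ] SymF2 :=
  aeval (fun n => (X (Sum.inl n) : SymF2))

/-- `f ↦ f(v)`. -/
noncomputable def toV : SymF →ₐ[ℚ] SymF2 :=
  aeval (fun n => (X (Sum.inr n) : SymF2))

/-- `f ↦ f(u - v)`, the difference of alphabets: `p_k ↦ p_k(u) - p_k(v)`. -/
noncomputable def toUV : SymF →ₐ[ℚ] SymF2 :=
  aeval (fun n => (X (Sum.inl n) : SymF2) - X (Sum.inr n))

namespace Ptn

/-- The parts in weakly decreasing order are the entries of any sorted list representing them. -/
theorem part_eq_getD_of_pairwise {l : Ptn} {L : List ℕ} (hL : l.parts = (L : Multiset ℕ))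
    (hs : L.Pairwise (· ≥ ·)) (i : ℕ) : l.part i = L.getD i 0 := by
  have h : (l.parts.sort (· ≤ ·)).reverse = L := by
    apply List.Perm.eq_of_pairwise (le := (· ≥ ·))
    · intro a b _ _ h1 h2
      exact le_antisymm h2 h1
    · rw [List.pairwise_reverse]
      exact Multiset.pairwise_sort _ _
    · exact hs
    · refine (List.reverse_perm _).trans ?_
      rw [← Multiset.coe_eq_coe, Multiset.sort_eq, hL]
  rw [part, h]

theorem getD_filter_pos {L : List ℕ} (hs : L.Pairwise (· ≥ ·)) (i : ℕ) :
    (L.filter (fun x => 0 < x)).getD i 0 = L.getD i 0 := by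
  induction L generalizing i with
  | nil => simp
  | cons a L ih =>
    rw [List.pairwise_cons] at hs
    rcases Nat.eq_zero_or_pos a with rfl | ha
    · have h0 : ∀ b ∈ L, b = 0 := fun b hb => Nat.le_zero.mp (hs.1 b hb)
      have h1 : (0 :: L).filter (fun x => 0 < x) = [] := by
        simp only [List.filter_eq_nil_iff]
        intro b hb
        rcases List.mem_cons.mp hb with rfl | hb
        · simp
        · simp [h0 b hb]
      rw [h1, List.getD_nil]
      cases i with
      | zero => simp
      | succ i =>
        rw [List.getD_cons_succ, ← ih hs.2]
        have : L.filter (fun x => 0 < x) = [] := by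
          simp only [List.filter_eq_nil_iff]
          intro b hb
          simp [h0 b hb]
        rw [this, List.getD_nil]
    · rw [List.filter_cons_of_pos (by simpa using ha)]
      cases i with
      | zero => simp
      | succ i => simpa using ih hs.2 i

theorem part_of_coe {L : List ℕ} (hs : L.Pairwise (· ≥ ·)) (i : ℕ) :
    (of (L : Multiset ℕ)).part i = L.getD i 0 := by
  rw [part_eq_getD_of_pairwise (L := L.filter (fun x => 0 < x)) _ (hs.filter _),
    getD_filter_pos hs]
  simp [of]

theorem part_of_range {K : ℕ} {f : ℕ → ℕ} (hf : ∀ i j, i ≤ j → j < K → f j ≤ f i) (i : ℕ) :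
    (of ((Multiset.range K).map f)).part i = if i < K then f i else 0 := by
  have h : (Multiset.range K).map f = (((List.range K).map f : List ℕ) : Multiset ℕ) := by
    rw [← Multiset.coe_range, Multiset.map_coe]
  rw [h, part_of_coe]
  · by_cases hi : i < K
    · simp [hi, List.getD]
    · simp [hi, List.getD]
  · rw [List.pairwise_map]
    refine List.pairwise_lt_range.imp_of_mem ?_
    intro a b _ hb hab
    exact hf a b hab.le (List.mem_range.mp hb)

/-- The decreasing list of the parts. -/
theorem exists_list (l : Ptn) : ∃ L : List ℕ, l.parts = (L : Multiset ℕ) ∧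
    L.Pairwise (· ≥ ·) ∧ (∀ i, l.part i = L.getD i 0) ∧ L.length = l.length := by
  refine ⟨(l.parts.sort (· ≤ ·)).reverse, ?_, ?_, fun i => rfl, ?_⟩
  · rw [Multiset.coe_reverse, Multiset.sort_eq]
  · rw [List.pairwise_reverse]
    exact Multiset.pairwise_sort _ _
  · simp [length]

theorem part_anti (l : Ptn) {i j : ℕ} (h : i ≤ j) : l.part j ≤ l.part i := by
  obtain ⟨L, -, hs, hp, -⟩ := l.exists_list
  rw [hp, hp]
  by_cases hj : j < L.length
  · rw [List.getD_eq_getElem _ _ hj, List.getD_eq_getElem _ _ (h.trans_lt hj)]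
    rcases h.eq_or_lt with rfl | h
    · exact le_rfl
    · exact List.pairwise_iff_getElem.mp hs i j (h.trans hj) hj h
  · rw [List.getD_eq_default _ _ (not_lt.mp hj)]
    exact Nat.zero_le _

theorem parts_eq_map_part (l : Ptn) : l.parts = (Multiset.range l.length).map l.part := by
  obtain ⟨L, hL, -, hp, hlen⟩ := l.exists_list
  rw [hL, ← Multiset.coe_range, Multiset.map_coe, ← hlen]
  congr 1
  apply List.ext_getElem
  · simp
  · intro i h1 h2
    simp [hp, h1]

theorem part_eq_zero {l : Ptn} {i : ℕ} (h : l.length ≤ i) : l.part i = 0 := by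
  obtain ⟨L, -, -, hp, hlen⟩ := l.exists_list
  rw [hp, List.getD_eq_default _ _ (by omega)]

theorem part_mem {l : Ptn} {i : ℕ} (h : i < l.length) : l.part i ∈ l.parts := by
  rw [parts_eq_map_part]
  exact Multiset.mem_map_of_mem _ (Multiset.mem_range.mpr h)

theorem part_pos_iff {l : Ptn} {i : ℕ} : 0 < l.part i ↔ i < l.length := by
  constructor
  · intro h
    by_contra hi
    rw [part_eq_zero (not_lt.mp hi)] at h
    exact lt_irrefl _ h
  · intro h
    exact l.pos _ (part_mem h)

theorem mem_parts_iff {l : Ptn} {x : ℕ} : x ∈ l.parts ↔ ∃ i < l.length, l.part i = x := by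
  rw [parts_eq_map_part]
  simp [Multiset.mem_map]

theorem ext_part {l l' : Ptn} (h : ∀ i, l.part i = l'.part i) : l = l' := by
  have hlen : l.length = l'.length := by
    apply le_antisymm
    · by_contra hc
      have := part_pos_iff.mpr (not_le.mp hc)
      rw [h] at this
      exact lt_irrefl _ (part_pos_iff.mp this)
    · by_contra hc
      have := part_pos_iff.mpr (not_le.mp hc)
      rw [← h] at this
      exact lt_irrefl _ (part_pos_iff.mp this)
  have hp : l.parts = l'.parts := by
    rw [parts_eq_map_part l, parts_eq_map_part l', hlen]
    exact Multiset.map_congr rfl (fun i _ => h i)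
  cases l
  cases l'
  simp only at hp
  subst hp
  rfl

theorem length_le_of_part_eq_zero {l : Ptn} {i : ℕ} (h : l.part i = 0) : l.length ≤ i := by
  by_contra hc
  exact (part_pos_iff.mpr (not_le.mp hc)).ne' h

theorem Strict.part_lt {l : Ptn} (hl : l.Strict) {i j : ℕ} (hij : i < j) (hj : j < l.length) :
    l.part j < l.part i := by
  refine lt_of_le_of_ne (l.part_anti hij.le) fun h => ?_
  have hn : ((Multiset.range l.length).map l.part).Nodup := by
    rw [← parts_eq_map_part]
    exact hl
  exact hij.ne' (Multiset.inj_on_of_nodup_map hn j (Multiset.mem_range.mpr hj) i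
    (Multiset.mem_range.mpr (hij.trans hj)) h)

/-- The strict-growth estimate `λ_j + (j - i) ≤ λ_i` for strict partitions. -/
theorem Strict.part_add_le {l : Ptn} (hl : l.Strict) {i j : ℕ} (hij : i ≤ j) (hj : j < l.length) :
    l.part j + j ≤ l.part i + i := by
  induction j, hij using Nat.le_induction with
  | base => exact le_rfl
  | succ j hij ih =>
    have := hl.part_lt (Nat.lt_succ_self j) hj
    have := ih (by omega)
    simp only [Nat.succ_eq_add_one] at *
    omega

end Ptn

theorem Multiset.map_range_reflect {α : Type*} (f : ℕ → α) (N : ℕ) :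
    (Multiset.range N).map f = (Multiset.range N).map (fun i => f (N - 1 - i)) := by
  have h := Finset.sum_range_reflect (fun i => ({f i} : Multiset α)) N
  simp only [Finset.sum, Finset.range_val] at h
  have h2 := fun g : ℕ → α => Multiset.sum_map_singleton ((Multiset.range N).map g)
  simp only [Multiset.map_map, Function.comp_def] at h2
  rw [h2, h2] at h
  exact h.symm

theorem le_of_strictMonoOn_range {N : ℕ} {f : ℕ → ℕ}
    (hf : ∀ i j, i < j → j < N → f i < f j) {i : ℕ} (hi : i < N) : i ≤ f i := by
  induction i with
  | zero => exact Nat.zero_le _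
  | succ i ih => exact (ih (by omega)).trans_lt (hf i (i + 1) (by omega) hi)

theorem card_filter_lt_of_strictMonoOn {N : ℕ} {f : ℕ → ℕ}
    (hf : ∀ i j, i < j → j < N → f i < f j) {i : ℕ} (hi : i < N) :
    (((Finset.range N).image f).filter (fun q => q < f i)).card = i := by
  have h : ((Finset.range N).image f).filter (fun q => q < f i) = (Finset.range i).image f := by
    ext q
    simp only [Finset.mem_filter, Finset.mem_image, Finset.mem_range]
    constructor
    · rintro ⟨⟨j, hj, rfl⟩, hlt⟩
      refine ⟨j, ?_, rfl⟩
      by_contra hc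
      rcases (not_lt.mp hc).eq_or_lt with rfl | h
      · exact lt_irrefl _ hlt
      · exact lt_asymm hlt (hf i j h hj)
    · rintro ⟨j, hj, rfl⟩
      exact ⟨⟨j, hj.trans hi, rfl⟩, hf j i hj hi⟩
  rw [h, Finset.card_image_of_injOn, Finset.card_range]
  intro a ha b hb hab
  simp only [Finset.coe_range, Set.mem_Iio] at ha hb
  rcases lt_trichotomy a b with h | h | h
  · exact absurd hab (hf a b h (hb.trans hi)).ne
  · exact h
  · exact absurd hab (hf b a h (ha.trans hi)).ne'

theorem injOn_of_strictMonoOn_range {N : ℕ} {f : ℕ → ℕ}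
    (hf : ∀ i j, i < j → j < N → f i < f j) : Set.InjOn f (Finset.range N) := by
  intro a ha b hb hab
  simp only [Finset.coe_range, Set.mem_Iio] at ha hb
  rcases lt_trichotomy a b with h | h | h
  · exact absurd hab (hf a b h hb).ne
  · exact h
  · exact absurd hab (hf b a h ha).ne.symm

/-- The parts of the partition encoded by an increasing enumeration of beads. -/
theorem part_ptnOfBeads {N : ℕ} {f : ℕ → ℕ} (hf : ∀ i j, i < j → j < N → f i < f j) (i : ℕ) :
    (ptnOfBeads ((Finset.range N).image f)).part i =
      if i < N then f (N - 1 - i) - (N - 1 - i) else 0 := by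
  have h : ptnOfBeads ((Finset.range N).image f) =
      Ptn.of ((Multiset.range N).map (fun i => f (N - 1 - i) - (N - 1 - i))) := by
    rw [ptnOfBeads, ← Multiset.map_range_reflect (fun i => f i - i),
      Finset.image_val_of_injOn (injOn_of_strictMonoOn_range hf), Finset.range_val,
      Multiset.map_map]
    congr 1
    apply Multiset.map_congr rfl
    intro j hj
    rw [Function.comp_apply, card_filter_lt_of_strictMonoOn hf (Multiset.mem_range.mp hj)]
  rw [h, Ptn.part_of_range]
  have step : ∀ a b, a ≤ b → b < N → f a - a ≤ f b - b := by
    intro a b hab hb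
    induction b, hab using Nat.le_induction with
    | base => exact le_rfl
    | succ b hab ih =>
      have := ih (by omega)
      have := hf b (b + 1) (by omega) hb
      omega
  intro a b hab hb
  exact step _ _ (by omega) (by omega)

/-- An increasing enumeration of a finite set of naturals. -/
theorem exists_enum (B : Finset ℕ) : ∃ f : ℕ → ℕ,
    (∀ i j, i < j → j < B.card → f i < f j) ∧ (Finset.range B.card).image f = B := by
  refine ⟨fun i => if h : i < B.card then B.orderEmbOfFin rfl ⟨i, h⟩ else 0, ?_, ?_⟩
  · intro i j hij hj
    simp only [hij.trans hj, hj, dif_pos]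
    exact (B.orderEmbOfFin rfl).strictMono hij
  · ext p
    simp only [Finset.mem_image, Finset.mem_range]
    constructor
    · rintro ⟨i, hi, rfl⟩
      simp [hi]
    · intro hp
      have : p ∈ Set.range (B.orderEmbOfFin rfl) := by simpa using hp
      obtain ⟨i, rfl⟩ := this
      exact ⟨i, i.2, by simp⟩

theorem length_ptnOfBeads_le (B : Finset ℕ) : (ptnOfBeads B).length ≤ B.card := by
  obtain ⟨f, hf, hB⟩ := exists_enum B
  apply Ptn.length_le_of_part_eq_zero
  have := part_ptnOfBeads hf B.card
  rwa [hB, if_neg (lt_irrefl _)] at this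

theorem betaSet_ptnOfBeads (B : Finset ℕ) : betaSet (ptnOfBeads B) B.card = B := by
  obtain ⟨f, hf, hB⟩ := exists_enum B
  have hp := part_ptnOfBeads hf
  rw [hB] at hp
  generalize B.card = N at *
  subst hB
  rw [betaSet]
  ext p
  simp only [Finset.mem_image, Finset.mem_range]
  constructor
  · rintro ⟨i, hi, rfl⟩
    refine ⟨N - 1 - i, by omega, ?_⟩
    have := le_of_strictMonoOn_range hf (show N - 1 - i < N by omega)
    rw [hp, if_pos hi]
    omega
  · rintro ⟨i, hi, rfl⟩
    refine ⟨N - 1 - i, by omega, ?_⟩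
    have := le_of_strictMonoOn_range hf hi
    rw [hp, if_pos (by omega), show N - 1 - (N - 1 - i) = i by omega]
    omega

/-- Prepending `d` beads at the bottom of an abacus. -/
def prependBeads (d : ℕ) (B : Finset ℕ) : Finset ℕ := Finset.range d ∪ B.image (fun p => d + p)

theorem mem_prependBeads {d : ℕ} {B : Finset ℕ} {p : ℕ} :
    p ∈ prependBeads d B ↔ p < d ∨ d ≤ p ∧ p - d ∈ B := by
  simp only [prependBeads, Finset.mem_union, Finset.mem_range, Finset.mem_image]
  refine or_congr_right ⟨?_, ?_⟩
  · rintro ⟨a, ha, rfl⟩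
    simp [ha]
  · rintro ⟨h1, h2⟩
    exact ⟨p - d, h2, by omega⟩

theorem betaSet_add {l : Ptn} {M : ℕ} (hM : l.length ≤ M) (d : ℕ) :
    betaSet l (M + d) = prependBeads d (betaSet l M) := by
  ext p
  rw [mem_prependBeads]
  simp only [betaSet, Finset.mem_image, Finset.mem_range]
  constructor
  · rintro ⟨i, hi, rfl⟩
    by_cases h : i < M
    · exact Or.inr ⟨by omega, i, h, by omega⟩
    · rw [Ptn.part_eq_zero (by omega)]
      left
      omega
  · rintro (h | ⟨h, i, hi, hp⟩)
    · refine ⟨M + d - 1 - p, by omega, ?_⟩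
      rw [Ptn.part_eq_zero (by omega)]
      omega
    · exact ⟨i, by omega, by omega⟩

theorem beta_strictMono (l : Ptn) (M : ℕ) :
    ∀ i j, i < j → j < M → l.part (M - 1 - i) + i < l.part (M - 1 - j) + j := by
  intro i j hij _
  have := l.part_anti (show M - 1 - j ≤ M - 1 - i by omega)
  omega

theorem betaSet_eq_image (l : Ptn) (M : ℕ) :
    betaSet l M = (Finset.range M).image (fun i => l.part (M - 1 - i) + i) := by
  ext p
  simp only [betaSet, Finset.mem_image, Finset.mem_range]
  constructor
  · rintro ⟨i, hi, rfl⟩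
    exact ⟨M - 1 - i, by omega, by rw [show M - 1 - (M - 1 - i) = i by omega]⟩
  · rintro ⟨i, hi, rfl⟩
    exact ⟨M - 1 - i, by omega, by rw [show M - 1 - (M - 1 - i) = i by omega]⟩

theorem card_betaSet (l : Ptn) (M : ℕ) : (betaSet l M).card = M := by
  rw [betaSet_eq_image, Finset.card_image_of_injOn
    (injOn_of_strictMonoOn_range (beta_strictMono l M)), Finset.card_range]

theorem ptnOfBeads_betaSet {l : Ptn} {M : ℕ} (hM : l.length ≤ M) :
    ptnOfBeads (betaSet l M) = l := by
  apply Ptn.ext_part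
  intro i
  rw [betaSet_eq_image, part_ptnOfBeads (beta_strictMono l M)]
  split_ifs with h
  · rw [show M - 1 - (M - 1 - i) = i by omega]
    omega
  · rw [Ptn.part_eq_zero (by omega)]

theorem ptnOfBeads_prependBeads (d : ℕ) (B : Finset ℕ) :
    ptnOfBeads (prependBeads d B) = ptnOfBeads B := by
  conv_lhs => rw [← betaSet_ptnOfBeads B, ← betaSet_add (length_ptnOfBeads_le B)]
  exact ptnOfBeads_betaSet ((length_ptnOfBeads_le B).trans (Nat.le_add_right _ _))

theorem rKey_prependBeads_of_lt (B : Finset ℕ) {d p : ℕ} (hp : p < 2 * d) :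
    rKey 2 (prependBeads (2 * d) B) p = p := by
  have h : (prependBeads (2 * d) B).filter (fun q => q % 2 = p % 2 ∧ q < p) =
      (Finset.range (p / 2)).image (fun s => 2 * s + p % 2) := by
    ext q
    simp only [Finset.mem_filter, mem_prependBeads, Finset.mem_image, Finset.mem_range]
    constructor
    · rintro ⟨-, h1, h2⟩
      exact ⟨q / 2, by omega, by omega⟩
    · rintro ⟨s, hs, rfl⟩
      omega
  rw [rKey, h, Finset.card_image_of_injective _ (fun a b hab => by simpa using hab),
    Finset.card_range]
  omega

theorem rKey_prependBeads_add (B : Finset ℕ) (d p : ℕ) :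
    rKey 2 (prependBeads (2 * d) B) (2 * d + p) = 2 * d + rKey 2 B p := by
  have h : (prependBeads (2 * d) B).filter
      (fun q => q % 2 = (2 * d + p) % 2 ∧ q < 2 * d + p) =
      (Finset.range d).image (fun s => 2 * s + p % 2) ∪
        (B.filter (fun q => q % 2 = p % 2 ∧ q < p)).image (fun q => 2 * d + q) := by
    ext q
    simp only [Finset.mem_filter, mem_prependBeads, Finset.mem_image, Finset.mem_range,
      Finset.mem_union]
    constructor
    · rintro ⟨h | ⟨h, hB⟩, h1, h2⟩
      · exact Or.inl ⟨q / 2, by omega, by omega⟩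
      · exact Or.inr ⟨q - 2 * d, ⟨hB, by omega, by omega⟩, by omega⟩
    · rintro (⟨s, hs, rfl⟩ | ⟨q, ⟨hB, h1, h2⟩, rfl⟩)
      · omega
      · refine ⟨Or.inr ⟨by omega, ?_⟩, by omega, by omega⟩
        simpa using hB
  rw [rKey, h, Finset.card_union_of_disjoint,
    Finset.card_image_of_injective _ (fun a b hab => by simpa using hab),
    Finset.card_image_of_injective _ (fun a b hab => by simpa using hab), Finset.card_range, rKey]
  · omega
  · rw [Finset.disjoint_left]
    simp only [Finset.mem_image, Finset.mem_range]
    rintro _ ⟨s, hs, rfl⟩ ⟨q, -, h⟩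
    omega

/-- Adding an even number of beads at the bottom does not change the inversions. -/
theorem inversions_prependBeads (B : Finset ℕ) (d : ℕ) :
    inversions (rKey 2 (prependBeads (2 * d) B)) (prependBeads (2 * d) B) =
      inversions (rKey 2 B) B := by
  symm
  rw [inversions, inversions]
  apply Finset.card_bij (fun pq _ => (2 * d + pq.1, 2 * d + pq.2))
  · rintro ⟨p, q⟩ h
    simp only [Finset.mem_filter, Finset.mem_product, mem_prependBeads] at h ⊢
    simp only [rKey_prependBeads_add]
    refine ⟨⟨Or.inr ⟨by omega, ?_⟩, Or.inr ⟨by omega, ?_⟩⟩, by omega, by omega⟩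
    · simpa using h.1.1
    · simpa using h.1.2
  · rintro ⟨p, q⟩ _ ⟨p', q'⟩ _ h
    simp only [Prod.mk.injEq] at h ⊢
    omega
  · rintro ⟨p, q⟩ h
    simp only [Finset.mem_filter, Finset.mem_product, mem_prependBeads] at h
    obtain ⟨⟨hp, hq⟩, hlt, hk⟩ := h
    by_cases hp' : p < 2 * d
    · exfalso
      rw [rKey_prependBeads_of_lt B hp'] at hk
      by_cases hq' : q < 2 * d
      · rw [rKey_prependBeads_of_lt B hq'] at hk
        omega
      · obtain ⟨q, rfl⟩ := Nat.exists_eq_add_of_le (not_lt.mp hq')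
        rw [rKey_prependBeads_add] at hk
        omega
    · have hq' : ¬ q < 2 * d := by omega
      obtain ⟨p, rfl⟩ := Nat.exists_eq_add_of_le (not_lt.mp hp')
      obtain ⟨q, rfl⟩ := Nat.exists_eq_add_of_le (not_lt.mp hq')
      rw [rKey_prependBeads_add, rKey_prependBeads_add] at hk
      refine ⟨(p, q), ?_, rfl⟩
      simp only [Finset.mem_filter, Finset.mem_product]
      simp only [hp', false_or, hq', Nat.add_sub_cancel_left] at hp hq
      exact ⟨⟨hp.2, hq.2⟩, by omega, by omega⟩

/-- The `2`-sign may be computed with any even number of beads. -/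
theorem rSign_ptnOfBeads {B : Finset ℕ} {n : ℕ} (hB : B.card = 2 * n) :
    rSign 2 (ptnOfBeads B) = (-1) ^ inversions (rKey 2 B) B := by
  set l := ptnOfBeads B with hl
  have hlen : l.length ≤ 2 * n := hB ▸ length_ptnOfBeads_le B
  have hb : betaSet l (2 * n) = B := hB ▸ betaSet_ptnOfBeads B
  rw [rSign, rSignExp]
  congr 1
  have e1 := inversions_prependBeads (betaSet l (2 * l.length)) n
  have e2 := inversions_prependBeads B l.length
  rw [← betaSet_add (by omega)] at e1
  rw [← hb, ← betaSet_add hlen, hb, add_comm] at e2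
  rw [← e1, e2]

theorem hSym_zero : hSym 0 = 1 := by
  rw [hSym, Fintype.sum_unique]
  have : (default : Nat.Partition 0).parts = 0 := by
    simp
  rw [this]
  simp [zval, pMult]

/-- The Jacobi–Trudi determinant may be padded with zero parts. -/
theorem schur_eq_det {l : Ptn} {M : ℕ} (hM : l.length ≤ M) :
    schur l = Matrix.det (Matrix.of (fun i j : Fin M =>
      hz ((l.part i.val : ℤ) + (j.val : ℤ) - (i.val : ℤ)))) := by
  induction M, hM using Nat.le_induction with
  | base => rfl
  | succ M hM ih =>
    rw [ih, Matrix.det_succ_row _ (Fin.last M), Finset.sum_eq_single (Fin.last M)]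
    · rw [Fin.succAbove_last]
      have h1 : (Even (M + M)) := ⟨M, rfl⟩
      simp only [Fin.val_last, h1.neg_one_pow, Matrix.of_apply, Ptn.part_eq_zero hM]
      simp only [Nat.cast_zero, zero_add, sub_self, hz, lt_irrefl, if_false, Int.toNat_zero,
        hSym_zero, one_mul]
      rfl
    · intro j _ hj
      have : j.val < M := by
        have := Fin.val_lt_last hj
        simpa using this
      have h2 : ((l.part M : ℤ) + (j.val : ℤ) - (M : ℤ)) < 0 := by
        rw [Ptn.part_eq_zero hM]
        omega
      have h3 : hz ((l.part M : ℤ) + (j.val : ℤ) - (M : ℤ)) = 0 := if_pos h2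
      simp only [Matrix.of_apply, Fin.val_last, h3, mul_zero, zero_mul]
    · simp

/-- The Schur function of a bead set as a determinant with rows indexed by the beads. -/
theorem schur_ptnOfBeads {B : Finset ℕ} {N : ℕ} (hB : B.card = N) :
    schur (ptnOfBeads B) = Matrix.det (Matrix.of (fun i j : Fin N =>
      hz ((B.orderEmbOfFin hB i : ℤ) - (j.val : ℤ)))) := by
  set l := ptnOfBeads B with hl
  have hlen : l.length ≤ N := hB ▸ length_ptnOfBeads_le B
  have hb : betaSet l N = B := hB ▸ betaSet_ptnOfBeads B
  have he : (fun i : Fin N => l.part (N - 1 - i) + i) = B.orderEmbOfFin hB := by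
    apply Finset.orderEmbOfFin_unique
    · intro i
      rw [← hb, betaSet_eq_image]
      exact Finset.mem_image_of_mem (fun i => l.part (N - 1 - i) + i) (Finset.mem_range.mpr i.2)
    · intro i j hij
      exact beta_strictMono l N i j hij j.2
  rw [schur_eq_det hlen, ← Matrix.det_submatrix_equiv_self Fin.revPerm, ← he]
  congr 1
  ext1 i j
  simp only [Matrix.submatrix_apply, Matrix.of_apply, Fin.revPerm_apply, Fin.val_rev]
  congr 1
  rw [show N - (i.val + 1) = N - 1 - i by omega]
  push_cast
  omega

/-- Reordering the rows of a determinant by increasing key costs the sign of the inversions. -/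
theorem neg_one_pow_inversions_mul_det {R : Type*} [CommRing R] {N : ℕ} {B : Finset ℕ}
    (hB : B.card = N) (key : ℕ → ℕ) (E : Fin N → ℕ) (hE : ∀ i, E i ∈ B)
    (hkey : ∀ i, key (E i) = i) (g : ℕ → Fin N → R) :
    (-1) ^ inversions key B * Matrix.det (Matrix.of fun i => g (B.orderEmbOfFin hB i)) =
      Matrix.det (Matrix.of fun i => g (E i)) := by
  have hEinj : Function.Injective E := fun a b hab => by
    apply Fin.ext
    rw [← hkey a, ← hkey b, hab]
  have hex : ∀ i, ∃ k, B.orderEmbOfFin hB k = E i := by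
    intro i
    have : E i ∈ Set.range (B.orderEmbOfFin hB) := by simpa using hE i
    exact this
  choose s hs using hex
  have hsinj : Function.Injective s := fun a b hab => hEinj (by rw [← hs, ← hs, hab])
  let σ : Equiv.Perm (Fin N) := Equiv.ofBijective s (Finite.injective_iff_bijective.mp hsinj)
  have hσ : ∀ i, B.orderEmbOfFin hB (σ i) = E i := hs
  have hτ : ∀ i, (σ⁻¹ i).val = key (B.orderEmbOfFin hB i) := by
    intro i
    rw [← hkey, ← hσ]
    simp
  have hdet : Matrix.det (Matrix.of fun i => g (E i)) =
      (Equiv.Perm.sign σ : ℤ) * Matrix.det (Matrix.of fun i => g (B.orderEmbOfFin hB i)) := by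
    rw [← Matrix.det_permute]
    congr 1
    ext1 i j
    simp [hσ]
  rw [hdet]
  congr 1
  have hsign : (Equiv.Perm.sign σ) = (-1) ^ inversions key B := by
    rw [← Equiv.Perm.sign_inv, Equiv.Perm.sign_eq_prod_prod_Iio, Finset.prod_sigma',
      Finset.prod_ite, Finset.prod_const_one, one_mul, Finset.prod_const, inversions]
    congr 1
    apply Finset.card_bij (fun x _ => (B.orderEmbOfFin hB x.2, B.orderEmbOfFin hB x.1))
    · rintro ⟨j, i⟩ h
      simp only [Finset.mem_filter, Finset.mem_sigma, Finset.mem_univ, Finset.mem_Iio,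
        true_and, not_lt] at h
      simp only [Finset.mem_filter, Finset.mem_product, Finset.orderEmbOfFin_mem, true_and,
        OrderEmbedding.lt_iff_lt]
      refine ⟨h.1, ?_⟩
      rw [← hτ, ← hτ]
      refine lt_of_le_of_ne h.2 fun hc => h.1.ne' ?_
      exact σ⁻¹.injective (Fin.ext hc)
    · rintro ⟨j, i⟩ _ ⟨j', i'⟩ _ h
      simp only [Prod.mk.injEq, EmbeddingLike.apply_eq_iff_eq] at h
      obtain ⟨rfl, rfl⟩ := h
      rfl
    · rintro ⟨p, q⟩ h
      simp only [Finset.mem_filter, Finset.mem_product] at h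
      obtain ⟨⟨hp, hq⟩, hlt, hk⟩ := h
      have hp' : p ∈ Set.range (B.orderEmbOfFin hB) := by simpa using hp
      have hq' : q ∈ Set.range (B.orderEmbOfFin hB) := by simpa using hq
      obtain ⟨i, rfl⟩ := hp'
      obtain ⟨j, rfl⟩ := hq'
      refine ⟨⟨j, i⟩, ?_, rfl⟩
      rw [← hτ, ← hτ] at hk
      simp only [Finset.mem_filter, Finset.mem_sigma, Finset.mem_univ, Finset.mem_Iio,
        true_and, not_lt]
      exact ⟨by simpa using hlt, hk.le⟩
  rw [hsign]
  simp

/-- The signed Schur function of a bead set, with rows in the order of the `2`-numbering. -/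
theorem rSign_smul_schur_ptnOfBeads {B : Finset ℕ} {n : ℕ} (hB : B.card = n * 2)
    (E : Fin (n * 2) → ℕ) (hE : ∀ i, E i ∈ B) (hkey : ∀ i, rKey 2 B (E i) = i) :
    rSign 2 (ptnOfBeads B) • schur (ptnOfBeads B) =
      Matrix.det (Matrix.of (fun i j : Fin (n * 2) => hz ((E i : ℤ) - (j.val : ℤ)))) := by
  rw [rSign_ptnOfBeads (n := n) (by omega), schur_ptnOfBeads hB,
    ← neg_one_pow_inversions_mul_det hB (rKey 2 B) E hE hkey (fun p j => hz ((p : ℤ) - (j : ℤ)))]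
  rw [zsmul_eq_mul]
  simp

/-- The power sum `p_k`, with the convention `p_0 = 0`. -/
noncomputable def powSum (k : ℕ) : SymF := if k = 0 then 0 else X (k - 1)

/-- The multisets of parts of the partitions of `n`. -/
noncomputable def partitionParts (n : ℕ) : Finset (Multiset ℕ) :=
  Finset.univ.map ⟨fun ρ : Nat.Partition n => ρ.parts, fun _ _ h => Nat.Partition.ext h⟩

theorem mem_partitionParts {n : ℕ} {s : Multiset ℕ} :
    s ∈ partitionParts n ↔ (∀ a ∈ s, 0 < a) ∧ s.sum = n := by
  simp only [partitionParts, Finset.mem_map, Finset.mem_univ, true_and]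
  constructor
  · rintro ⟨ρ, rfl⟩
    exact ⟨fun a ha => ρ.parts_pos ha, ρ.parts_sum⟩
  · rintro ⟨h1, h2⟩
    exact ⟨⟨s, fun {a} ha => h1 a ha, h2⟩, rfl⟩

theorem hSym_eq_sum (n : ℕ) :
    hSym n = ∑ s ∈ partitionParts n, (zval s)⁻¹ • pMult s := by
  rw [partitionParts, Finset.sum_map]
  rfl

theorem zval_cons {a : ℕ} (s : Multiset ℕ) :
    zval (a ::ₘ s) = (a * (s.count a + 1 : ℕ) : ℚ) * zval s := by
  have hsub : s.toFinset ⊆ insert a s.toFinset := Finset.subset_insert _ _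
  have h1 : zval s = ∏ b ∈ insert a s.toFinset,
      ((b : ℚ) ^ s.count b * (Nat.factorial (s.count b) : ℚ)) := by
    refine Finset.prod_subset hsub fun b _ hb => ?_
    rw [Multiset.mem_toFinset] at hb
    simp [Multiset.count_eq_zero_of_notMem hb]
  rw [h1, zval, Multiset.toFinset_cons]
  rw [← Finset.mul_prod_erase _ _ (Finset.mem_insert_self a s.toFinset),
    ← Finset.mul_prod_erase _ _ (Finset.mem_insert_self a s.toFinset), ← mul_assoc]
  congr 1
  · rw [Multiset.count_cons_self, pow_succ, Nat.factorial_succ]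
    push_cast
    ring
  · refine Finset.prod_congr rfl fun b hb => ?_
    rw [Multiset.count_cons_of_ne (Finset.ne_of_mem_erase hb)]

theorem pMult_cons {a : ℕ} (ha : 0 < a) (s : Multiset ℕ) :
    pMult (a ::ₘ s) = powSum a * pMult s := by
  simp [pMult, powSum, ha.ne.symm]

/-- The Newton identity `n h_n = ∑ p_k h_{n-k}`. -/
theorem newton_hSym (n : ℕ) :
    (n : SymF) * hSym n = ∑ x ∈ Finset.HasAntidiagonal.antidiagonal n, powSum x.1 * hSym x.2 := by
  have hL : (n : SymF) * hSym n = ∑ x ∈ (partitionParts n).sigma (fun s => s.toFinset),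
      ((x.2 * x.1.count x.2 : ℕ) * (zval x.1)⁻¹ : ℚ) • pMult x.1 := by
    rw [hSym_eq_sum, Finset.mul_sum, Finset.sum_sigma]
    refine Finset.sum_congr rfl fun s hs => ?_
    dsimp only
    rw [← Finset.sum_smul, ← Finset.sum_mul, ← Nat.cast_sum]
    have : ∑ a ∈ s.toFinset, a * s.count a = n := by
      rw [← (mem_partitionParts.mp hs).2, Finset.sum_multiset_count]
      exact Finset.sum_congr rfl fun a _ => by rw [smul_eq_mul, mul_comm]
    rw [this, mul_smul, Nat.cast_smul_eq_nsmul, nsmul_eq_mul]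
  have hR : ∑ x ∈ Finset.HasAntidiagonal.antidiagonal n, powSum x.1 * hSym x.2 =
      ∑ x ∈ ((Finset.HasAntidiagonal.antidiagonal n).filter (fun x => 0 < x.1)).sigma
        (fun x => partitionParts x.2), (zval x.2)⁻¹ • (powSum x.1.1 * pMult x.2) := by
    rw [Finset.sum_sigma, Finset.sum_filter]
    refine Finset.sum_congr rfl fun x _ => ?_
    split_ifs with h
    · rw [hSym_eq_sum, Finset.mul_sum]
      exact Finset.sum_congr rfl fun s _ => by rw [mul_smul_comm]
    · have : x.1 = 0 := by omega
      simp [powSum, this]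
  rw [hL, hR]
  symm
  refine Finset.sum_bij' (fun x _ => ⟨x.1.1 ::ₘ x.2, x.1.1⟩)
    (fun x _ => ⟨(x.2, n - x.2), x.1.erase x.2⟩) ?_ ?_ ?_ ?_ ?_
  · rintro ⟨⟨a, b⟩, s⟩ h
    simp only [Finset.mem_sigma, Finset.mem_filter, Finset.HasAntidiagonal.mem_antidiagonal,
      mem_partitionParts] at h
    simp only [Finset.mem_sigma, mem_partitionParts, Multiset.mem_toFinset, Multiset.mem_cons,
      true_or, and_true, Multiset.sum_cons]
    refine ⟨?_, by omega⟩
    rintro c (rfl | hc)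
    · exact h.1.2
    · exact h.2.1 c hc
  · rintro ⟨s, a⟩ h
    simp only [Finset.mem_sigma, mem_partitionParts, Multiset.mem_toFinset] at h
    simp only [Finset.mem_sigma, Finset.mem_filter, Finset.HasAntidiagonal.mem_antidiagonal,
      mem_partitionParts]
    have hs := Multiset.cons_erase h.2
    have hsum : a + (s.erase a).sum = n := by
      rw [← Multiset.sum_cons, hs]
      exact h.1.2
    refine ⟨⟨by omega, h.1.1 a h.2⟩, fun c hc => h.1.1 c (Multiset.mem_of_mem_erase hc), by omega⟩
  · rintro ⟨⟨a, b⟩, s⟩ h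
    simp only [Finset.mem_sigma, Finset.mem_filter, Finset.HasAntidiagonal.mem_antidiagonal] at h
    have : n - a = b := by omega
    simp [this]
  · rintro ⟨s, a⟩ h
    simp only [Finset.mem_sigma, Multiset.mem_toFinset] at h
    simp [Multiset.cons_erase h.2]
  · rintro ⟨⟨a, b⟩, s⟩ h
    simp only [Finset.mem_sigma, Finset.mem_filter] at h
    have ha : 0 < a := h.1.2
    have hne : ((a * (s.count a + 1 : ℕ) : ℚ)) ≠ 0 := by positivity
    simp only [pMult_cons ha, zval_cons, Multiset.count_cons_self]
    congr 1
    push_cast at hne ⊢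
    rw [mul_inv, ← mul_assoc, mul_inv_cancel₀ hne, one_mul]

/-- A power series over a `ℚ`-algebra is determined by its logarithmic derivative and its
constant coefficient. -/
theorem PowerSeries.ext_of_euler {Q F G : PowerSeries SymF} (hQ : PowerSeries.coeff 0 Q = 0)
    (h0 : PowerSeries.coeff 0 F = PowerSeries.coeff 0 G)
    (hF : PowerSeries.X * PowerSeries.derivative SymF F = Q * F)
    (hG : PowerSeries.X * PowerSeries.derivative SymF G = Q * G) : F = G := by
  ext1 n
  induction n using Nat.strong_induction_on with
  | _ n ih =>
    cases n with
    | zero => exact h0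
    | succ n =>
      have e : ∀ {F : PowerSeries SymF},
          PowerSeries.X * PowerSeries.derivative SymF F = Q * F →
          PowerSeries.coeff (n + 1) F * ((n : SymF) + 1) =
          ∑ x ∈ Finset.HasAntidiagonal.antidiagonal (n + 1),
            PowerSeries.coeff x.1 Q * PowerSeries.coeff x.2 F := by
        intro F hF
        have := congrArg (PowerSeries.coeff (n + 1)) hF
        rwa [PowerSeries.coeff_succ_X_mul, PowerSeries.coeff_derivative,
          PowerSeries.coeff_mul] at this
      have key : PowerSeries.coeff (n + 1) F * ((n : SymF) + 1) =
          PowerSeries.coeff (n + 1) G * ((n : SymF) + 1) := by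
        rw [e hF, e hG]
        refine Finset.sum_congr rfl fun x hx => ?_
        rw [Finset.HasAntidiagonal.mem_antidiagonal] at hx
        rcases Nat.eq_zero_or_pos x.1 with h | h
        · rw [h, hQ, zero_mul, zero_mul]
        · rw [ih x.2 (by omega)]
      exact mul_right_cancel₀ (by exact_mod_cast Nat.succ_ne_zero n) key

theorem coeff_X_mul_derivative (F : PowerSeries SymF) (n : ℕ) :
    PowerSeries.coeff n (PowerSeries.X * PowerSeries.derivative SymF F) =
      n * PowerSeries.coeff n F := by
  cases n with
  | zero => simp
  | succ n =>
    rw [PowerSeries.coeff_succ_X_mul, PowerSeries.coeff_derivative, mul_comm]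
    push_cast
    rfl

theorem pleth_powSum (k : ℕ) : pleth 2 (powSum k) = powSum (2 * k) := by
  rcases Nat.eq_zero_or_pos k with rfl | hk
  · simp [pleth, powSum]
  · rw [powSum, powSum, if_neg (by omega), if_neg (by omega), pleth, aeval_X]
    congr 1
    omega

/-- The plethysm `p_2 ∘ h_{M/2}`, understood to vanish for odd `M`. -/
noncomputable def plethHalf (M : ℕ) : SymF := if Even M then pleth 2 (hSym (M / 2)) else 0

theorem euler_plethHalf (M : ℕ) : (M : SymF) * plethHalf M =
    ∑ x ∈ Finset.HasAntidiagonal.antidiagonal M,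
      (if Even x.1 then 2 * powSum x.1 else 0) * plethHalf x.2 := by
  by_cases hM : Even M
  · obtain ⟨k, rfl⟩ := hM
    have h1 : plethHalf (k + k) = pleth 2 (hSym k) := by
      rw [plethHalf, if_pos ⟨k, rfl⟩, show (k + k) / 2 = k by omega]
    have h2 := congrArg (pleth 2) (newton_hSym k)
    simp only [pleth, map_mul, map_sum, map_natCast] at h2
    simp only [← pleth.eq_1, pleth_powSum] at h2
    rw [h1, Nat.cast_add, ← two_mul, mul_assoc, h2, Finset.mul_sum]
    refine Finset.sum_of_injOn (fun x => (2 * x.1, 2 * x.2)) ?_ ?_ ?_ ?_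
    · rintro ⟨a, b⟩ _ ⟨c, d⟩ _ h
      simp only [Prod.mk.injEq] at h ⊢
      omega
    · rintro ⟨a, b⟩ h
      simp only [Finset.mem_coe, Finset.HasAntidiagonal.mem_antidiagonal] at h ⊢
      omega
    · rintro ⟨a, b⟩ h hn
      simp only [Finset.HasAntidiagonal.mem_antidiagonal] at h
      by_cases ha : Even a
      · exfalso
        apply hn
        obtain ⟨c, rfl⟩ := ha
        refine ⟨(c, k - c), ?_, ?_⟩
        · simp only [Finset.mem_coe, Finset.HasAntidiagonal.mem_antidiagonal]
          omega
        · simp only [Prod.mk.injEq]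
          omega
      · rw [if_neg ha, zero_mul]
    · rintro ⟨a, b⟩ h
      simp only
      rw [if_pos (even_two_mul a), plethHalf, if_pos (even_two_mul b),
        Nat.mul_div_cancel_left b two_pos, mul_assoc]
  · rw [plethHalf, if_neg hM, mul_zero]
    symm
    refine Finset.sum_eq_zero fun x hx => ?_
    rw [Finset.HasAntidiagonal.mem_antidiagonal] at hx
    by_cases h1 : Even x.1
    · have h2 : ¬ Even x.2 := fun h2 => hM (hx ▸ h1.add h2)
      rw [plethHalf, if_neg h2, mul_zero]
    · rw [if_neg h1, zero_mul]

/-- The coefficientwise form of `H(-t) H(t) = p_2 ∘ H(t)`. -/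
theorem sum_neg_one_pow_hSym_mul_hSym (M : ℕ) :
    ∑ x ∈ Finset.HasAntidiagonal.antidiagonal M, (-1) ^ x.1 * hSym x.1 * hSym x.2 =
      plethHalf M := by
  set H : PowerSeries SymF := PowerSeries.mk hSym with hH
  set P : PowerSeries SymF := PowerSeries.mk powSum with hP
  set r := PowerSeries.rescale (-1 : SymF) with hr
  set Q : PowerSeries SymF := PowerSeries.mk (fun k => if Even k then 2 * powSum k else 0) with hQ
  have eH : PowerSeries.X * PowerSeries.derivative SymF H = P * H := by
    ext1 n
    rw [coeff_X_mul_derivative, PowerSeries.coeff_mul]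
    simp only [hH, hP, PowerSeries.coeff_mk]
    exact newton_hSym n
  have erH : PowerSeries.X * PowerSeries.derivative SymF (r H) = r P * r H := by
    rw [← map_mul, ← eH]
    ext1 n
    rw [coeff_X_mul_derivative, hr, PowerSeries.coeff_rescale, PowerSeries.coeff_rescale,
      coeff_X_mul_derivative]
    ring
  have hPQ : r P + P = Q := by
    ext1 n
    simp only [hr, hP, hQ, map_add, PowerSeries.coeff_rescale, PowerSeries.coeff_mk]
    by_cases hn : Even n
    · rw [hn.neg_one_pow, if_pos hn]
      ring
    · rw [(Nat.not_even_iff_odd.mp hn).neg_one_pow, if_neg hn]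
      ring
  have key : r H * H = PowerSeries.mk plethHalf := by
    apply PowerSeries.ext_of_euler (Q := Q)
    · simp [hQ, powSum]
    · rw [PowerSeries.coeff_mul]
      simp [hr, hH, hSym_zero, plethHalf, pleth]
    · rw [Derivation.leibniz, smul_eq_mul, smul_eq_mul, mul_add, mul_left_comm, eH,
        mul_left_comm PowerSeries.X, erH, ← hPQ]
      ring
    · ext1 n
      rw [coeff_X_mul_derivative, PowerSeries.coeff_mul]
      simp only [hQ, PowerSeries.coeff_mk]
      exact euler_plethHalf n
  have := congrArg (PowerSeries.coeff M) key
  rw [PowerSeries.coeff_mul] at this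
  simpa [hr, hH, PowerSeries.coeff_rescale] using this

/-- Powers of a sum of square-zero elements are multiples of elementary symmetric sums. -/
theorem sum_pow_of_sq_eq_zero {ι A : Type*} [DecidableEq ι] [CommRing A] (z : ι → A)
    (hz : ∀ k, z k * z k = 0) (K : Finset ι) (n : ℕ) :
    (∑ k ∈ K, z k) ^ n = n.factorial * ∑ C ∈ K.powersetCard n, ∏ k ∈ C, z k := by
  induction K using Finset.induction_on generalizing n with
  | empty =>
    cases n with
    | zero => simp
    | succ n => rw [Finset.powersetCard_eq_empty.mpr (by simp)]; simp
  | insert a K ha ih =>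
    cases n with
    | zero => simp
    | succ n =>
      have hexp : (∑ k ∈ insert a K, z k) ^ (n + 1) = (∑ k ∈ K, z k) ^ (n + 1) +
          (n + 1 : ℕ) * (z a * (∑ k ∈ K, z k) ^ n) := by
        rw [Finset.sum_insert ha]
        generalize ∑ k ∈ K, z k = Z
        have hdvd : ∀ j, (z a + Z) ^ (j + 1) = Z ^ (j + 1) + (j + 1 : ℕ) * (z a * Z ^ j) := by
          intro j
          induction j with
          | zero => simp [add_comm]
          | succ j ihj =>
            rw [pow_succ, ihj]
            push_cast
            linear_combination ((j : A) + 1) * Z ^ j * hz a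
        exact hdvd n
      rw [hexp, ih, ih, Finset.powersetCard_succ_insert ha, Finset.sum_union, Finset.sum_image]
      · have : ∀ C ∈ K.powersetCard n, ∏ k ∈ insert a C, z k = z a * ∏ k ∈ C, z k := by
          intro C hC
          exact Finset.prod_insert fun h => ha ((Finset.mem_powersetCard.mp hC).1 h)
        rw [Finset.sum_congr rfl this, ← Finset.mul_sum, Nat.factorial_succ]
        push_cast
        ring
      · intro C hC D hD h
        have h1 : a ∉ C := fun h => ha ((Finset.mem_powersetCard.mp hC).1 h)
        have h2 : a ∉ D := fun h => ha ((Finset.mem_powersetCard.mp hD).1 h)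
        rw [← Finset.erase_insert h1, ← Finset.erase_insert h2, h]
      · rw [Finset.disjoint_left]
        intro C hC hD
        obtain ⟨D, -, rfl⟩ := Finset.mem_image.mp hD
        exact ha ((Finset.mem_powersetCard.mp hC).1 (Finset.mem_insert_self a D))

/-- The family `x 0, y 0, x 1, y 1, …`. -/
def interleave {n : ℕ} {V : Type*} (x y : Fin n → V) (p : Fin (n * 2)) : V :=
  if p.val % 2 = 0 then x p.divNat else y p.divNat

section Exterior

variable {R V : Type*} [CommRing R] [AddCommGroup V] [Module R V]

theorem ι_mul_ι_eq_neg (x y : V) : ExteriorAlgebra.ι R x * ExteriorAlgebra.ι R y =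
    -(ExteriorAlgebra.ι R y * ExteriorAlgebra.ι R x) :=
  eq_neg_of_add_eq_zero_left (ExteriorAlgebra.ι_add_mul_swap x y)

theorem ι_mul_ι_comm (x y x' y' : V) :
    (ExteriorAlgebra.ι R x * ExteriorAlgebra.ι R y) *
      (ExteriorAlgebra.ι R x' * ExteriorAlgebra.ι R y') =
    (ExteriorAlgebra.ι R x' * ExteriorAlgebra.ι R y') *
      (ExteriorAlgebra.ι R x * ExteriorAlgebra.ι R y) := by
  have h1 : ∀ a : V, ExteriorAlgebra.ι R a *
      (ExteriorAlgebra.ι R x' * ExteriorAlgebra.ι R y') =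
      (ExteriorAlgebra.ι R x' * ExteriorAlgebra.ι R y') * ExteriorAlgebra.ι R a := by
    intro a
    rw [← mul_assoc, ι_mul_ι_eq_neg a x', neg_mul, mul_assoc, ι_mul_ι_eq_neg a y', mul_neg,
      neg_neg, mul_assoc]
  rw [mul_assoc, h1 y, ← mul_assoc, h1 x, mul_assoc]

theorem ι_mul_ι_sq (x y : V) :
    (ExteriorAlgebra.ι R x * ExteriorAlgebra.ι R y) *
      (ExteriorAlgebra.ι R x * ExteriorAlgebra.ι R y) = 0 := by
  rw [mul_assoc, ← mul_assoc (ExteriorAlgebra.ι R y), ι_mul_ι_eq_neg y x, neg_mul, mul_neg,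
    mul_assoc, ExteriorAlgebra.ι_sq_zero, mul_zero, mul_zero, neg_zero]

theorem ιMulti_interleave {n : ℕ} (x y : Fin n → V) :
    ExteriorAlgebra.ιMulti R (n * 2) (interleave x y) =
      (List.ofFn fun i => ExteriorAlgebra.ι R (x i) * ExteriorAlgebra.ι R (y i)).prod := by
  rw [ExteriorAlgebra.ιMulti_apply, List.ofFn_mul, List.prod_flatten, List.map_ofFn]
  congr 2
  funext i
  have h0 : (⟨i.val * 2, by omega⟩ : Fin (n * 2)).divNat = i := by
    ext
    simp [Fin.divNat]
  have h1 : (⟨i.val * 2 + 1, by omega⟩ : Fin (n * 2)).divNat = i := by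
    ext
    simp only [Fin.divNat]
    omega
  simp [interleave, List.ofFn_succ, h0, h1]

variable [NoZeroDivisors R] [CharZero R]

open scoped IsMulCommutative in
/-- If `∑ x_k ∧ y_k` equals a sum of `n` products of two vectors, then taking the `n`-th
divided power gives an identity between alternating forms of interleaved families. -/
theorem sum_alternating_interleave_eq {n : ℕ} (f : V [⋀^Fin (n * 2)]→ₗ[R] R) {K : Finset ℕ}
    (x y : ℕ → V) (x' y' : Fin n → V)
    (h : ∑ k ∈ K, ExteriorAlgebra.ι R (x k) * ExteriorAlgebra.ι R (y k) =
      ∑ a, ExteriorAlgebra.ι R (x' a) * ExteriorAlgebra.ι R (y' a))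
    (F : Finset ℕ → R)
    (hF : ∀ C ∈ K.powersetCard n, ∃ c : Fin n → ℕ, Function.Injective c ∧
      Finset.univ.image c = C ∧ F C = f (interleave (x ∘ c) (y ∘ c))) :
    ∑ C ∈ K.powersetCard n, F C = f (interleave x' y') := by
  classical
  let S : Set (ExteriorAlgebra R V) :=
    {w | ∃ a b : V, w = ExteriorAlgebra.ι R a * ExteriorAlgebra.ι R b}
  have hcomm : ∀ a ∈ S, ∀ b ∈ S, a * b = b * a := by
    rintro _ ⟨a, b, rfl⟩ _ ⟨a', b', rfl⟩
    exact ι_mul_ι_comm a b a' b'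
  let A := Algebra.adjoin R S
  have hA : IsMulCommutative A := Algebra.isMulCommutative_adjoin R hcomm
  let w : V → V → A := fun a b => ⟨ExteriorAlgebra.ι R a * ExteriorAlgebra.ι R b,
    Algebra.subset_adjoin ⟨a, b, rfl⟩⟩
  have hw : ∀ a b, w a b * w a b = 0 := fun a b => Subtype.ext (ι_mul_ι_sq a b)
  let L : ExteriorAlgebra R V →ₗ[R] R :=
    ExteriorAlgebra.liftAlternating (Function.update (fun _ => 0) (n * 2) f)
  let L' : A →ₗ[R] R := L ∘ₗ A.val.toLinearMap
  have hL : ∀ a b : Fin n → V, L' (∏ i, w (a i) (b i)) = f (interleave a b) := by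
    intro a b
    have h1 : ((∏ i, w (a i) (b i) : A) : ExteriorAlgebra R V) =
        ExteriorAlgebra.ιMulti R (n * 2) (interleave a b) := by
      rw [ιMulti_interleave, ← List.prod_ofFn]
      rw [← A.coe_val, map_list_prod, List.map_ofFn]
      rfl
    change L ((∏ i, w (a i) (b i) : A) : ExteriorAlgebra R V) = _
    rw [h1]
    simp only [L]
    rw [ExteriorAlgebra.liftAlternating_apply_ιMulti, Function.update_self]
  have hsum : ∑ k ∈ K, w (x k) (y k) = ∑ a, w (x' a) (y' a) := by
    apply Subtype.ext
    rw [← A.coe_val, map_sum, map_sum]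
    exact h
  have hpow := congrArg (fun t => L' (t ^ n)) hsum
  rw [sum_pow_of_sq_eq_zero _ (fun k => hw _ _), sum_pow_of_sq_eq_zero _ (fun k => hw _ _)] at hpow
  have hun : (Finset.univ : Finset (Fin n)).powersetCard n = {Finset.univ} := by
    have := Finset.powersetCard_self (Finset.univ : Finset (Fin n))
    rwa [Finset.card_univ, Fintype.card_fin] at this
  rw [hun, Finset.sum_singleton, ← nsmul_eq_mul, ← nsmul_eq_mul, map_nsmul, map_nsmul, hL,
    map_sum, nsmul_eq_mul, nsmul_eq_mul] at hpow
  have hfac : (n.factorial : R) ≠ 0 := by exact_mod_cast n.factorial_ne_zero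
  rw [← mul_left_cancel₀ hfac hpow]
  refine Finset.sum_congr rfl fun C hC => ?_
  obtain ⟨c, hc, rfl, hFC⟩ := hF C hC
  rw [hFC, ← hL, Finset.prod_image hc.injOn]
  rfl

end Exterior

section Exterior

variable {R : Type*} [CommRing R] {N : ℕ}

theorem ι_mul_ι_eq_sum (x y : Fin N → R) :
    ExteriorAlgebra.ι R x * ExteriorAlgebra.ι R y =
      ∑ i, ∑ j, (x i * y j) • (ExteriorAlgebra.ι R (Pi.single i (1 : R)) *
        ExteriorAlgebra.ι R (Pi.single j (1 : R))) := by
  have h : ∀ z : Fin N → R, ExteriorAlgebra.ι R z =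
      ∑ i, z i • ExteriorAlgebra.ι R (Pi.single i (1 : R)) := by
    intro z
    conv_lhs => rw [pi_eq_sum_univ' z]
    rw [map_sum]
    refine Finset.sum_congr rfl fun i _ => ?_
    rw [map_smul]
  rw [h x, h y, Finset.sum_mul_sum]
  refine Finset.sum_congr rfl fun i _ => Finset.sum_congr rfl fun j _ => ?_
  rw [smul_mul_smul_comm]

theorem two_smul_sum_ι_mul_ι {κ : Type*} (K : Finset κ) (x y : κ → Fin N → R) :
    (2 : R) • ∑ k ∈ K, ExteriorAlgebra.ι R (x k) * ExteriorAlgebra.ι R (y k) =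
      ∑ i, ∑ j, (∑ k ∈ K, x k i * y k j - ∑ k ∈ K, x k j * y k i) •
        (ExteriorAlgebra.ι R (Pi.single i (1 : R)) *
          ExteriorAlgebra.ι R (Pi.single j (1 : R))) := by
  have h1 : ∑ k ∈ K, ExteriorAlgebra.ι R (x k) * ExteriorAlgebra.ι R (y k) =
      ∑ i, ∑ j, (∑ k ∈ K, x k i * y k j) • (ExteriorAlgebra.ι R (Pi.single i (1 : R)) *
        ExteriorAlgebra.ι R (Pi.single j (1 : R))) := by
    rw [Finset.sum_congr rfl fun k _ => ι_mul_ι_eq_sum (x k) (y k), Finset.sum_comm]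
    refine Finset.sum_congr rfl fun i _ => ?_
    rw [Finset.sum_comm]
    refine Finset.sum_congr rfl fun j _ => ?_
    rw [Finset.sum_smul]
  have h2 : ∑ i, ∑ j, (∑ k ∈ K, x k j * y k i) •
      (ExteriorAlgebra.ι R (Pi.single i (1 : R)) *
        ExteriorAlgebra.ι R (Pi.single j (1 : R))) =
      -∑ k ∈ K, ExteriorAlgebra.ι R (x k) * ExteriorAlgebra.ι R (y k) := by
    rw [h1, Finset.sum_comm, ← Finset.sum_neg_distrib]
    refine Finset.sum_congr rfl fun i _ => ?_
    rw [← Finset.sum_neg_distrib]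
    refine Finset.sum_congr rfl fun j _ => ?_
    rw [ι_mul_ι_eq_neg, smul_neg]
  simp_rw [sub_smul, Finset.sum_sub_distrib]
  rw [h2, ← h1, two_smul, sub_neg_eq_add]

/-- Two sums of products of vectors agree in the exterior algebra as soon as the antisymmetrised
coefficient matrices agree. -/
theorem sum_ι_mul_ι_eq {κ κ' : Type*} [Invertible (2 : R)] (K : Finset κ) (K' : Finset κ')
    (x y : κ → Fin N → R) (x' y' : κ' → Fin N → R)
    (h : ∀ i j, ∑ k ∈ K, x k i * y k j - ∑ k ∈ K, x k j * y k i =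
      ∑ k ∈ K', x' k i * y' k j - ∑ k ∈ K', x' k j * y' k i) :
    ∑ k ∈ K, ExteriorAlgebra.ι R (x k) * ExteriorAlgebra.ι R (y k) =
      ∑ k ∈ K', ExteriorAlgebra.ι R (x' k) * ExteriorAlgebra.ι R (y' k) := by
  have e : (2 : R) • ∑ k ∈ K, ExteriorAlgebra.ι R (x k) * ExteriorAlgebra.ι R (y k) =
      (2 : R) • ∑ k ∈ K', ExteriorAlgebra.ι R (x' k) * ExteriorAlgebra.ι R (y' k) := by
    rw [two_smul_sum_ι_mul_ι, two_smul_sum_ι_mul_ι]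
    simp_rw [h]
  have e2 := congrArg (fun t => (⅟2 : R) • t) e
  simpa only [smul_smul, invOf_mul_self, one_smul] using e2

end Exterior

/-- The permutation reversing the odd-indexed positions. -/
def revOdd (n : ℕ) : Equiv.Perm (Fin (n * 2)) :=
  Function.Involutive.toPerm
    (fun p => ⟨if p.val % 2 = 0 then p.val else n * 2 - p.val, by split_ifs <;> omega⟩) (by
      intro p
      ext
      dsimp only
      split_ifs <;> omega)

theorem val_revOdd {n : ℕ} (p : Fin (n * 2)) :
    (revOdd n p).val = if p.val % 2 = 0 then p.val else n * 2 - p.val := rfl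

theorem interleave_rev {n : ℕ} {V : Type*} (x y : Fin n → V) :
    interleave x (fun i => y i.rev) = interleave x y ∘ revOdd n := by
  funext p
  have hp := p.2
  have hr := val_revOdd p
  rw [Function.comp_apply, interleave, interleave]
  by_cases h : p.val % 2 = 0
  · rw [if_pos h] at hr
    rw [Fin.ext hr]
    simp [h]
  · rw [if_neg h] at hr
    rw [if_neg h, if_neg (by omega)]
    have : p.divNat.rev = (revOdd n p).divNat := by
      ext
      simp only [Fin.divNat, Fin.val_rev, hr]
      omega
    rw [this]

theorem det_interleave_rev {n : ℕ} {R : Type*} [CommRing R] (x y : Fin n → Fin (n * 2) → R) :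
    Matrix.det (Matrix.of (interleave x (fun i => y i.rev))) =
      (Equiv.Perm.sign (revOdd n) : ℤ) * Matrix.det (Matrix.of (interleave x y)) := by
  rw [← Matrix.det_permute, interleave_rev]
  rfl

/-- The position `2 a + r` for `r < 2`. -/
def evenOddEquiv (n : ℕ) : Fin n ⊕ Fin n ≃ Fin (n * 2) where
  toFun := Sum.elim (fun a => ⟨2 * a, by omega⟩) (fun a => ⟨2 * a + 1, by omega⟩)
  invFun p := if p.val % 2 = 0 then Sum.inl p.divNat else Sum.inr p.divNat
  left_inv := by
    rintro (a | a)
    · simp [Fin.divNat]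
    · have h : (2 * a.val + 1) / 2 = a := by omega
      simp [Fin.divNat, Nat.add_mod, h]
  right_inv := by
    intro p
    by_cases h : p.val % 2 = 0
    · simp only [h, if_true, Sum.elim_inl]
      ext
      simp only [Fin.divNat]
      omega
    · simp only [h, if_false, Sum.elim_inr]
      ext
      simp only [Fin.divNat]
      omega

/-- The vector supported on odd positions with given odd entries. -/
def oddVec {R : Type*} [Zero R] {n : ℕ} (w : Fin n → R) (p : Fin (n * 2)) : R :=
  if p.val % 2 = 0 then 0 else w p.divNat

theorem det_interleave_single_oddVec {n : ℕ} {R : Type*} [CommRing R]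
    (W : Matrix (Fin n) (Fin n) R) :
    Matrix.det (Matrix.of (interleave
      (fun a : Fin n => Pi.single (⟨2 * a, by omega⟩ : Fin (n * 2)) (1 : R))
      (fun a => oddVec (W a)))) = W.det := by
  rw [← Matrix.det_submatrix_equiv_self (evenOddEquiv n)]
  have : (Matrix.of (interleave
      (fun a : Fin n => Pi.single (⟨2 * a, by omega⟩ : Fin (n * 2)) (1 : R))
      (fun a => oddVec (W a)))).submatrix (evenOddEquiv n) (evenOddEquiv n) =
      Matrix.fromBlocks 1 0 0 W := by
    ext i j
    rcases i with a | a <;> rcases j with b | b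
    · have : (⟨2 * a.val, by omega⟩ : Fin (n * 2)).divNat = a := by
        ext
        simp [Fin.divNat]
      simp [evenOddEquiv, interleave, this, Pi.single_apply, Matrix.one_apply, Fin.ext_iff,
        eq_comm]
    · have : (⟨2 * a.val, by omega⟩ : Fin (n * 2)).divNat = a := by
        ext
        simp [Fin.divNat]
      have hne : (⟨2 * b.val + 1, by omega⟩ : Fin (n * 2)) ≠ ⟨2 * a.val, by omega⟩ := by
        rw [Ne, Fin.ext_iff]
        dsimp only
        omega
      simp [evenOddEquiv, interleave, this, Pi.single_eq_of_ne hne]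
    · simp [evenOddEquiv, interleave, oddVec, Nat.add_mod]
    · have e : ∀ a : Fin n, (⟨2 * a.val + 1, by omega⟩ : Fin (n * 2)).divNat = a := by
        intro a
        ext
        simp only [Fin.divNat]
        omega
      simp [evenOddEquiv, interleave, oddVec, Nat.add_mod, e]
  rw [this, Matrix.det_fromBlocks_zero₂₁, Matrix.det_one, one_mul]

theorem hz_of_neg {k : ℤ} (h : k < 0) : hz k = 0 := if_pos h

theorem hz_natCast (k : ℕ) : hz k = hSym k := by
  rw [hz, if_neg (by omega), Int.toNat_natCast]

theorem sum_range_two_mul {A : Type*} [AddCommMonoid A] (f : ℕ → A) (L : ℕ) :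
    ∑ p ∈ Finset.range (2 * L), f p =
      ∑ c ∈ Finset.range L, f (2 * c) + ∑ c ∈ Finset.range L, f (2 * c + 1) := by
  induction L with
  | zero => simp
  | succ L ih =>
    rw [show 2 * (L + 1) = 2 * L + 1 + 1 by ring, Finset.sum_range_succ, Finset.sum_range_succ, ih,
      Finset.sum_range_succ, Finset.sum_range_succ]
    abel

theorem sum_neg_one_pow_hz_mul_hz (L i j : ℕ) :
    ∑ p ∈ Finset.range (2 * L), (-1 : SymF) ^ p * (hz ((p : ℤ) - i) *
      hz ((2 * L - 1 - p : ℤ) - j)) =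
      if i + j + 1 ≤ 2 * L then (-1) ^ i * plethHalf (2 * L - 1 - i - j) else 0 := by
  split_ifs with hij
  · rw [← sum_neg_one_pow_hSym_mul_hSym, Finset.mul_sum]
    symm
    refine Finset.sum_of_injOn (fun x => x.1 + i) ?_ ?_ ?_ ?_
    · rintro ⟨a, b⟩ h ⟨c, d⟩ h' he
      simp only [Finset.mem_coe, Finset.HasAntidiagonal.mem_antidiagonal] at h h' he
      simp only [Prod.mk.injEq]
      omega
    · rintro ⟨a, b⟩ h
      simp only [Finset.mem_coe, Finset.HasAntidiagonal.mem_antidiagonal, Finset.mem_range] at h ⊢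
      omega
    · intro p hp hn
      rw [Finset.mem_range] at hp
      by_cases h1 : (p : ℤ) - i < 0
      · rw [hz_of_neg h1, zero_mul, mul_zero]
      · by_cases h2 : (2 * L - 1 - p : ℤ) - j < 0
        · rw [hz_of_neg h2, mul_zero, mul_zero]
        · exfalso
          apply hn
          refine ⟨(p - i, 2 * L - 1 - p - j), ?_, ?_⟩
          · simp only [Finset.mem_coe, Finset.HasAntidiagonal.mem_antidiagonal]
            omega
          · dsimp only
            omega
    · rintro ⟨a, b⟩ h
      simp only [Finset.HasAntidiagonal.mem_antidiagonal] at h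
      have h1 : ((a + i : ℕ) : ℤ) - i = a := by push_cast; ring
      have h2 : (2 * L - 1 - (a + i : ℕ) : ℤ) - j = b := by omega
      simp only [h1, h2, hz_natCast, pow_add]
      ring
  · refine Finset.sum_eq_zero fun p hp => ?_
    rw [Finset.mem_range] at hp
    by_cases h1 : (p : ℤ) - i < 0
    · rw [hz_of_neg h1, zero_mul, mul_zero]
    · rw [hz_of_neg (k := (2 * L - 1 - p : ℤ) - j) (by omega), mul_zero, mul_zero]

/-- The rows of the even beads. -/
noncomputable def evenRow (N c : ℕ) (j : Fin N) : SymF := hz (((2 * c : ℕ) : ℤ) - j.val)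

/-- The rows of the odd beads opposite to the even ones. -/
noncomputable def oddRow (N L c : ℕ) (j : Fin N) : SymF :=
  hz (((2 * L - 1 - 2 * c : ℕ) : ℤ) - j.val)

theorem antisymm_evenRow_oddRow (N L : ℕ) (i j : Fin N) :
    ∑ c ∈ Finset.range L, evenRow N c i * oddRow N L c j -
      ∑ c ∈ Finset.range L, evenRow N c j * oddRow N L c i =
      if i.val + j.val + 1 ≤ 2 * L then
        (-1) ^ i.val * plethHalf (2 * L - 1 - i.val - j.val) else 0 := by
  rw [← sum_neg_one_pow_hz_mul_hz, sum_range_two_mul, sub_eq_add_neg]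
  congr 1
  · refine Finset.sum_congr rfl fun c hc => ?_
    rw [Finset.mem_range] at hc
    rw [(even_two_mul c).neg_one_pow, one_mul, evenRow, oddRow]
    congr 2
    omega
  · rw [← Finset.sum_range_reflect, ← Finset.sum_neg_distrib]
    refine Finset.sum_congr rfl fun c hc => ?_
    rw [Finset.mem_range] at hc
    rw [(odd_two_mul_add_one c).neg_one_pow, neg_one_mul, evenRow, oddRow, mul_comm]
    congr 3
    · omega
    · omega

/-- The matrix `p_2 ∘ h_{L-1-a-b}`. -/
noncomputable def plethMatrix (n L : ℕ) : Matrix (Fin n) (Fin n) SymF :=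
  Matrix.of fun a b => pleth 2 (hz ((L : ℤ) - 1 - a.val - b.val))

theorem sum_single_mul_oddVec {n : ℕ} {R : Type*} [CommRing R] (W : Matrix (Fin n) (Fin n) R)
    (i j : Fin (n * 2)) :
    ∑ a : Fin n, (Pi.single (⟨2 * a, by omega⟩ : Fin (n * 2)) (1 : R) : Fin (n * 2) → R) i *
      oddVec (W a) j =
      if i.val % 2 = 0 ∧ j.val % 2 = 1 then W i.divNat j.divNat else 0 := by
  by_cases hi : i.val % 2 = 0
  · rw [Finset.sum_eq_single i.divNat]
    · have : (⟨2 * i.divNat.val, by omega⟩ : Fin (n * 2)) = i := by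
        ext
        simp only [Fin.divNat]
        omega
      rw [this, Pi.single_eq_same, one_mul, oddVec]
      by_cases hj : j.val % 2 = 0
      · rw [if_pos hj, if_neg (by omega)]
      · rw [if_neg hj, if_pos (by omega)]
    · intro a _ ha
      rw [Pi.single_eq_of_ne, zero_mul]
      intro h
      apply ha
      rw [h]
      ext
      simp [Fin.divNat]
    · simp
  · rw [if_neg (by omega)]
    refine Finset.sum_eq_zero fun a _ => ?_
    rw [Pi.single_eq_of_ne, zero_mul]
    intro h
    rw [h] at hi
    simp at hi

theorem plethMatrix_of_even_of_odd {n L : ℕ} (i j : Fin (n * 2)) (hi : i.val % 2 = 0)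
    (hj : j.val % 2 = 1) : plethMatrix n L i.divNat j.divNat =
      if i.val + j.val + 1 ≤ 2 * L then plethHalf (2 * L - 1 - i.val - j.val) else 0 := by
  rw [plethMatrix, Matrix.of_apply]
  simp only [Fin.divNat]
  split_ifs with h
  · have hev : Even (2 * L - 1 - i.val - j.val) := by
      rw [Nat.even_iff]
      omega
    rw [plethHalf, if_pos hev, ← hz_natCast]
    congr 2
    omega
  · rw [hz_of_neg (by omega), pleth, map_zero]

theorem sum_ι_evenRow_mul_ι_oddRow (n L : ℕ) :
    ∑ c ∈ Finset.range L, ExteriorAlgebra.ι SymF (evenRow (n * 2) c) *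
      ExteriorAlgebra.ι SymF (oddRow (n * 2) L c) =
    ∑ a : Fin n, ExteriorAlgebra.ι SymF
        (Pi.single (⟨2 * a, by omega⟩ : Fin (n * 2)) (1 : SymF)) *
      ExteriorAlgebra.ι SymF (oddVec (plethMatrix n L a)) := by
  have : Invertible (2 : SymF) := by
    refine ⟨C (1 / 2), ?_, ?_⟩ <;>
    · rw [show (2 : SymF) = C 2 from (map_ofNat C 2).symm, ← C_mul]
      norm_num
  apply sum_ι_mul_ι_eq
  intro i j
  rw [antisymm_evenRow_oddRow, sum_single_mul_oddVec, sum_single_mul_oddVec]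
  rcases Nat.mod_two_eq_zero_or_one i.val with hi | hi <;>
    rcases Nat.mod_two_eq_zero_or_one j.val with hj | hj
  · rw [if_neg (c := i.val % 2 = 0 ∧ _) (by omega), if_neg (c := j.val % 2 = 0 ∧ _) (by omega)]
    split_ifs with h
    · rw [plethHalf, if_neg, mul_zero, sub_zero]
      rw [Nat.even_iff]
      omega
    · rw [sub_zero]
  · rw [if_pos (c := i.val % 2 = 0 ∧ _) (by omega), if_neg (c := j.val % 2 = 0 ∧ _) (by omega),
      plethMatrix_of_even_of_odd i j hi hj, (Nat.even_iff.mpr hi).neg_one_pow, one_mul, sub_zero]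
  · rw [if_neg (c := i.val % 2 = 0 ∧ _) (by omega), if_pos (c := j.val % 2 = 0 ∧ _) (by omega),
      plethMatrix_of_even_of_odd j i hj hi, (Nat.odd_iff.mpr hi).neg_one_pow, zero_sub,
      add_comm j.val, Nat.sub_right_comm _ j.val]
    split_ifs
    · rw [neg_one_mul]
    · rw [neg_zero]
  · rw [if_neg (c := i.val % 2 = 0 ∧ _) (by omega), if_neg (c := j.val % 2 = 0 ∧ _) (by omega)]
    split_ifs with h
    · rw [plethHalf, if_neg, mul_zero, sub_zero]
      rw [Nat.even_iff]
      omega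
    · rw [sub_zero]

theorem schur_rect (n m : ℕ) : schur (rect n m) =
    Matrix.det (Matrix.of fun i j : Fin n => hz ((m : ℤ) + j.val - i.val)) := by
  have hp : ∀ i, (rect n m).part i = if i < n then m else 0 := by
    intro i
    have h : rect n m = Ptn.of ((Multiset.range n).map (fun _ => m)) := by
      rw [rect, Multiset.map_const', Multiset.card_range]
    rw [h, Ptn.part_of_range (fun _ _ _ _ => le_rfl)]
  have hlen : (rect n m).length ≤ n := Ptn.length_le_of_part_eq_zero (by rw [hp, if_neg (by omega)])
  rw [schur_eq_det hlen]
  congr 1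
  ext1 i j
  simp [hp]

theorem det_plethMatrix_rev {n m : ℕ} :
    Matrix.det (Matrix.of fun a => plethMatrix n (n + m) a.rev) = pleth 2 (schur (rect n m)) := by
  rw [schur_rect, pleth, AlgHom.map_det, ← Matrix.det_transpose]
  congr 1
  ext1 a b
  simp only [Matrix.transpose_apply, Matrix.of_apply, plethMatrix, pleth, AlgHom.mapMatrix_apply,
    Matrix.map_apply, Fin.val_rev]
  congr 2
  omega

/-- The signed sum over balanced bead sets. -/
theorem sum_det_interleave_evenRow_oddRow (n m : ℕ) (F : Finset ℕ → SymF)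
    (hF : ∀ C ∈ (Finset.range (n + m)).powersetCard n, ∃ c : Fin n → ℕ, Function.Injective c ∧
      Finset.univ.image c = C ∧ F C = Matrix.det (Matrix.of (interleave
        (fun i => evenRow (n * 2) (c i)) (fun i => oddRow (n * 2) (n + m) (c i.rev))))) :
    ∑ C ∈ (Finset.range (n + m)).powersetCard n, F C = pleth 2 (schur (rect n m)) := by
  set s : SymF := ((Equiv.Perm.sign (revOdd n) : ℤ) : SymF) with hs
  have hss : s * s = 1 := by
    rw [hs, ← Int.cast_mul, ← Units.val_mul, Int.units_mul_self]
    simp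
  have key := sum_alternating_interleave_eq
    (Matrix.detRowAlternating (n := Fin (n * 2)) (R := SymF))
    (K := Finset.range (n + m)) (evenRow (n * 2)) (oddRow (n * 2) (n + m)) _ _
    (sum_ι_evenRow_mul_ι_oddRow n (n + m)) (fun C => s * F C) (by
      intro C hC
      obtain ⟨c, hc, hC, hFC⟩ := hF C hC
      refine ⟨c, hc, hC, ?_⟩
      rw [hFC, det_interleave_rev (fun i => evenRow (n * 2) (c i))
        (fun i => oddRow (n * 2) (n + m) (c i)), ← hs, ← mul_assoc, hss, one_mul]
      rfl)
  rw [← Finset.mul_sum] at key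
  have h2 := congrArg (fun t => s * t) key
  rw [← mul_assoc, hss, one_mul] at h2
  have h3 := det_interleave_rev
    (fun a : Fin n => Pi.single (⟨2 * a, by omega⟩ : Fin (n * 2)) (1 : SymF))
    (fun a => oddVec (plethMatrix n (n + m) a))
  have h4 : Matrix.det (Matrix.of (interleave
      (fun a : Fin n => Pi.single (⟨2 * a, by omega⟩ : Fin (n * 2)) (1 : SymF))
      (fun a => oddVec (plethMatrix n (n + m) a.rev)))) = pleth 2 (schur (rect n m)) :=
    (det_interleave_single_oddVec (Matrix.of fun a => plethMatrix n (n + m) a.rev)).trans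
      det_plethMatrix_rev
  rw [h2, ← h4, h3]
  rfl

theorem lt_card_filter_range_iff {l : ℕ} {P : ℕ → Prop} [DecidablePred P]
    (hP : ∀ i j, i ≤ j → j < l → P j → P i) {j : ℕ} (hj : j < l) :
    j < ((Finset.range l).filter P).card ↔ P j := by
  constructor
  · intro h
    by_contra hn
    have hsub : (Finset.range l).filter P ⊆ Finset.range j := by
      intro i hi
      rw [Finset.mem_filter, Finset.mem_range] at hi
      rw [Finset.mem_range]
      by_contra hij
      exact hn (hP j i (not_lt.mp hij) hi.1 hi.2)
    have := Finset.card_le_card hsub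
    rw [Finset.card_range] at this
    omega
  · intro h
    have hsub : Finset.range (j + 1) ⊆ (Finset.range l).filter P := by
      intro i hi
      rw [Finset.mem_range] at hi
      rw [Finset.mem_filter, Finset.mem_range]
      exact ⟨by omega, hP i j (by omega) hj h⟩
    have := Finset.card_le_card hsub
    rw [Finset.card_range] at this
    omega

namespace Ptn

theorem Strict.card_row_filter {l : Ptn} (hl : l.Strict) {i : ℕ} (hi : i < l.length) :
    ((Finset.range (min i l.length)).filter (fun j => i + 1 ≤ j + l.part j)).card = i := by
  rw [min_eq_left hi.le, Finset.filter_true_of_mem, Finset.card_range]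
  intro j hj
  rw [Finset.mem_range] at hj
  have h1 := hl.part_add_le hj.le hi
  have h2 := part_pos_iff.mpr hi
  omega

theorem Strict.part_double {l : Ptn} (hl : l.Strict) (i : ℕ) :
    (double l).part i = if i < l.length then l.part i + 1 + i else
      ((Finset.range l.length).filter (fun j => i + 1 ≤ j + l.part j)).card := by
  rw [double, part_of_range]
  · by_cases hi : i < l.length
    · rw [if_pos (by omega), if_pos hi, if_pos hi, hl.card_row_filter hi]
    · rw [if_neg hi, if_neg hi, min_eq_right (not_lt.mp hi), zero_add]
      split_ifs with h
      · rfl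
      · symm
        rw [Finset.card_eq_zero, Finset.filter_eq_empty_iff]
        intro j hj
        rw [Finset.mem_range] at hj
        have := l.part_anti (Nat.zero_le j)
        omega
  · intro i j hij _
    by_cases hj : j < l.length
    · have hi : i < l.length := by omega
      rw [if_pos hi, if_pos hj, hl.card_row_filter hi, hl.card_row_filter hj]
      have := hl.part_add_le hij hj
      omega
    · rw [if_neg hj, min_eq_right (not_lt.mp hj), zero_add]
      by_cases hi : i < l.length
      · rw [if_pos hi, hl.card_row_filter hi]
        have h1 := Finset.card_filter_le (Finset.range l.length) (fun k => j + 1 ≤ k + l.part k)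
        rw [Finset.card_range] at h1
        have h2 := hl.part_add_le (show i ≤ l.length - 1 by omega) (by omega)
        have h3 := part_pos_iff.mpr (show l.length - 1 < l.length by omega)
        omega
      · rw [if_neg hi, min_eq_right (not_lt.mp hi), zero_add]
        apply Finset.card_le_card
        intro k
        simp only [Finset.mem_filter]
        rintro ⟨hk, h⟩
        exact ⟨hk, by omega⟩

theorem Strict.length_le_length_double {l : Ptn} (hl : l.Strict) :
    l.length ≤ (double l).length := by
  by_contra hc
  have h := part_eq_zero (le_refl (double l).length)
  rw [hl.part_double, if_pos (not_le.mp hc)] at h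
  omega

theorem Strict.part_zero_le_length_double {l : Ptn} (hl : l.Strict) :
    l.part 0 ≤ (double l).length := by
  by_contra hc
  have h := part_eq_zero (le_refl (double l).length)
  rw [hl.part_double, if_neg (not_lt.mpr hl.length_le_length_double), Finset.card_eq_zero,
    Finset.filter_eq_empty_iff] at h
  exact h (Finset.mem_range.mpr (part_pos_iff.mp (by omega : 0 < l.part 0))) (by omega)

end Ptn

/-- The bead configuration of the double of a strict partition is antisymmetric about its
middle, up to a shift by one. -/
theorem mem_betaSet_double {l : Ptn} (hl : l.Strict) {M p : ℕ} (hM : (double l).length ≤ M) :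
    p ∈ betaSet (double l) M ↔
      (p < M ∧ M - p ∉ l.parts) ∨ (M ≤ p ∧ p - M ∈ l.parts) := by
  have hlM := hl.length_le_length_double.trans hM
  have hpM := hl.part_zero_le_length_double.trans hM
  have hbound : ∀ x ∈ l.parts, 0 < x ∧ x ≤ M := by
    intro x hx
    obtain ⟨i, -, rfl⟩ := Ptn.mem_parts_iff.mp hx
    exact ⟨l.pos _ hx, (l.part_anti (Nat.zero_le i)).trans hpM⟩
  set T : Finset ℕ := (Finset.range M \ l.parts.toFinset.image (fun x => M - x)) ∪
    l.parts.toFinset.image (fun x => M + x) with hT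
  have hTmem : ∀ q, q ∈ T ↔ (q < M ∧ M - q ∉ l.parts) ∨ (M ≤ q ∧ q - M ∈ l.parts) := by
    intro q
    simp only [hT, Finset.mem_union, Finset.mem_sdiff, Finset.mem_range, Finset.mem_image,
      Multiset.mem_toFinset, not_exists, not_and]
    refine or_congr (and_congr_right fun hq => ⟨fun h hx => h _ hx (by omega), ?_⟩) ⟨?_, ?_⟩
    · intro h x hx hxq
      have := hbound x hx
      exact h (by rwa [show M - q = x by omega])
    · rintro ⟨x, hx, rfl⟩
      exact ⟨by omega, by rwa [Nat.add_sub_cancel_left]⟩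
    · rintro ⟨h1, h2⟩
      exact ⟨_, h2, by omega⟩
  have hlc : l.parts.toFinset.card = l.length := Multiset.toFinset_card_of_nodup hl
  have hcard : T.card = M := by
    rw [hT, Finset.card_union_of_disjoint, Finset.card_sdiff_of_subset, Finset.card_range,
      Finset.card_image_of_injOn, Finset.card_image_of_injOn, hlc]
    · omega
    · intro a _ b _ hab
      simpa using hab
    · intro a ha b hb hab
      have h1 := hbound a (by simpa using ha)
      have h2 := hbound b (by simpa using hb)
      simp only at hab
      omega
    · intro q hq
      obtain ⟨x, hx, rfl⟩ := Finset.mem_image.mp hq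
      have := hbound x (by simpa using hx)
      rw [Finset.mem_range]
      omega
    · rw [Finset.disjoint_left]
      intro q hq hq2
      obtain ⟨x, hx, rfl⟩ := Finset.mem_image.mp hq2
      have := Finset.mem_range.mp (Finset.mem_sdiff.mp hq).1
      omega
  have hsub : betaSet (double l) M ⊆ T := by
    intro q hq
    obtain ⟨i, hi, rfl⟩ := Finset.mem_image.mp hq
    rw [Finset.mem_range] at hi
    rw [hTmem, hl.part_double]
    by_cases hil : i < l.length
    · rw [if_pos hil]
      right
      refine ⟨by omega, ?_⟩
      rw [show l.part i + 1 + i + (M - 1 - i) - M = l.part i by omega]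
      exact Ptn.part_mem hil
    · rw [if_neg hil]
      left
      have hc := Finset.card_filter_le (Finset.range l.length) (fun j => i + 1 ≤ j + l.part j)
      rw [Finset.card_range] at hc
      refine ⟨by omega, fun hx => ?_⟩
      obtain ⟨j, hj, hx⟩ := Ptn.mem_parts_iff.mp hx
      have hiff := lt_card_filter_range_iff (P := fun j => i + 1 ≤ j + l.part j)
        (fun a b hab hb h => by have := hl.part_add_le hab hb; omega) hj
      omega
  rw [Finset.eq_of_subset_of_card_le hsub (by rw [hcard, card_betaSet]), hTmem]

/-- The partition obtained from `Λ_ℓ` by lengthening the parts `3 k + 1` with `k ∈ S`. -/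
def addOnes (ℓ : ℕ) (S : Finset ℕ) : Ptn :=
  Ptn.of ((Multiset.range ℓ).map (fun k => 3 * k + 1 + if k ∈ S then 1 else 0))

theorem addOnes_empty (ℓ : ℕ) : addOnes ℓ ∅ = LamP ℓ := by
  simp [addOnes, LamP]

theorem parts_addOnes (ℓ : ℕ) (S : Finset ℕ) : (addOnes ℓ S).parts =
    (Multiset.range ℓ).map (fun k => 3 * k + 1 + if k ∈ S then 1 else 0) := by
  rw [addOnes, Ptn.of, Multiset.filter_eq_self]
  intro x hx
  obtain ⟨k, -, rfl⟩ := Multiset.mem_map.mp hx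
  omega

theorem part_addOnes (ℓ : ℕ) (S : Finset ℕ) (i : ℕ) : (addOnes ℓ S).part i =
    if i < ℓ then 3 * (ℓ - 1 - i) + 1 + if ℓ - 1 - i ∈ S then 1 else 0 else 0 := by
  rw [addOnes, Multiset.map_range_reflect, Ptn.part_of_range]
  intro i j hij hj
  rcases hij.eq_or_lt with rfl | hij
  · exact le_rfl
  · split_ifs <;> omega

theorem length_addOnes (ℓ : ℕ) (S : Finset ℕ) : (addOnes ℓ S).length = ℓ := by
  rw [Ptn.length, parts_addOnes, Multiset.card_map, Multiset.card_range]

theorem strict_addOnes (ℓ : ℕ) (S : Finset ℕ) : (addOnes ℓ S).Strict := by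
  rw [Ptn.Strict, parts_addOnes]
  refine Multiset.Nodup.map_on ?_ (Multiset.nodup_range _)
  intro x _ y _ h
  split_ifs at h <;> omega

theorem three_mul_add_one_mem_addOnes {ℓ k : ℕ} {S : Finset ℕ} :
    3 * k + 1 ∈ (addOnes ℓ S).parts ↔ k < ℓ ∧ k ∉ S := by
  rw [parts_addOnes, Multiset.mem_map]
  constructor
  · rintro ⟨a, ha, h⟩
    rw [Multiset.mem_range] at ha
    split_ifs at h with haS
    · omega
    · obtain rfl : a = k := by omega
      exact ⟨ha, haS⟩
  · rintro ⟨hk, hS⟩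
    exact ⟨k, Multiset.mem_range.mpr hk, by rw [if_neg hS]⟩

theorem three_mul_add_two_mem_addOnes {ℓ k : ℕ} {S : Finset ℕ} :
    3 * k + 2 ∈ (addOnes ℓ S).parts ↔ k < ℓ ∧ k ∈ S := by
  rw [parts_addOnes, Multiset.mem_map]
  constructor
  · rintro ⟨a, ha, h⟩
    rw [Multiset.mem_range] at ha
    split_ifs at h with haS
    · obtain rfl : a = k := by omega
      exact ⟨ha, haS⟩
    · omega
  · rintro ⟨hk, hS⟩
    exact ⟨k, Multiset.mem_range.mpr hk, by rw [if_pos hS]⟩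

theorem size_addOnes {ℓ : ℕ} {S : Finset ℕ} (hS : S ⊆ Finset.range ℓ) :
    (addOnes ℓ S).size = (LamP ℓ).size + S.card := by
  have h : ∀ T : Finset ℕ, (addOnes ℓ T).size =
      ∑ k ∈ Finset.range ℓ, (3 * k + 1 + if k ∈ T then 1 else 0) := by
    intro T
    rw [Ptn.size, parts_addOnes]
    rfl
  rw [← addOnes_empty, h, h, Finset.sum_add_distrib]
  simp only [Finset.notMem_empty, if_false, add_zero,
    Finset.sum_boole, Finset.filter_mem_eq_inter, Finset.inter_eq_right.mpr hS, Nat.cast_id]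

theorem injOn_addOnes (ℓ m : ℕ) :
    Set.InjOn (addOnes ℓ) ((Finset.range ℓ).powersetCard m : Finset (Finset ℕ)) := by
  intro S hS T hT h
  rw [Finset.mem_coe, Finset.mem_powersetCard] at hS hT
  ext k
  have h1 := three_mul_add_two_mem_addOnes (ℓ := ℓ) (k := k) (S := S)
  rw [h, three_mul_add_two_mem_addOnes] at h1
  constructor
  · intro hk
    exact (h1.mpr ⟨Finset.mem_range.mp (hS.1 hk), hk⟩).2
  · intro hk
    exact (h1.mp ⟨Finset.mem_range.mp (hT.1 hk), hk⟩).2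

theorem F1Lam_eq_image (ℓ m : ℕ) : F1Lam ℓ m =
    addOnes ℓ '' ((Finset.range ℓ).powersetCard m : Finset (Finset ℕ)) := by
  ext mu
  simp only [F1Lam, Set.mem_ofPred_eq, Set.mem_image, Finset.mem_coe, Finset.mem_powersetCard,
    ← addOnes_empty ℓ, Contains]
  have hempty : ∀ i, (addOnes ℓ ∅).part i = if i < ℓ then 3 * (ℓ - 1 - i) + 1 else 0 := by
    intro i
    rw [part_addOnes]
    simp
  constructor
  · rintro ⟨-, hc, hsize, hlab⟩
    set S := (Finset.range ℓ).filter (fun k => mu.part (ℓ - 1 - k) = 3 * k + 2) with hS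
    have hSsub : S ⊆ Finset.range ℓ := Finset.filter_subset _ _
    have hmu : addOnes ℓ S = mu := by
      apply Ptn.ext_part
      intro i
      have h1 := hc i
      have h2 := hlab i
      rw [hempty] at h1 h2
      rw [part_addOnes]
      by_cases hi : i < ℓ
      · rw [if_pos hi] at h1 h2 ⊢
        have h3 : ¬ 3 * (ℓ - 1 - i) + 2 < mu.part i := fun h => by
          have := h2 _ (by omega) h
          omega
        have hmem : ℓ - 1 - i ∈ S ↔ mu.part i = 3 * (ℓ - 1 - i) + 2 := by
          rw [hS, Finset.mem_filter, Finset.mem_range, show ℓ - 1 - (ℓ - 1 - i) = i by omega]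
          exact ⟨fun h => h.2, fun h => ⟨by omega, h⟩⟩
        simp only [hmem]
        split_ifs <;> omega
      · rw [if_neg hi] at h2 ⊢
        by_contra hne
        have := h2 0 le_rfl (by omega)
        omega
    refine ⟨S, ⟨hSsub, ?_⟩, hmu⟩
    rw [← hmu, size_addOnes hSsub, addOnes_empty] at hsize
    omega
  · rintro ⟨S, ⟨hS, hcard⟩, rfl⟩
    refine ⟨strict_addOnes ℓ S, fun i => ?_, ?_, fun i j hj hjmu => ?_⟩
    · rw [hempty, part_addOnes]
      split_ifs <;> omega
    · rw [size_addOnes hS, addOnes_empty, hcard]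
    · rw [hempty] at hj
      rw [part_addOnes] at hjmu
      split_ifs at hj hjmu <;> omega

/-- The beads at positions `2 c` and `2 ℓ - 1 - 2 c` for `c ∈ C`. -/
def balancedBeads (ℓ : ℕ) (C : Finset ℕ) : Finset ℕ :=
  C.image (fun c => 2 * c) ∪ C.image (fun c => 2 * ℓ - 1 - 2 * c)

/-- Bead positions below `2 ℓ`, up to reflection, are indexed both by `c < ℓ` through the even
position `2 c` and by the distance from the middle; this converts the former to the latter. -/
def toMiddle (ℓ c : ℕ) : ℕ := if 2 * c < ℓ then ℓ - 1 - 2 * c else 2 * c - ℓ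

/-- The inverse of `toMiddle`. -/
def ofMiddle (ℓ k : ℕ) : ℕ := if (ℓ + k) % 2 = 0 then (ℓ + k) / 2 else (ℓ - 1 - k) / 2

theorem toMiddle_lt {ℓ c : ℕ} (h : c < ℓ) : toMiddle ℓ c < ℓ := by
  rw [toMiddle]
  split_ifs <;> omega

theorem ofMiddle_lt {ℓ k : ℕ} (h : k < ℓ) : ofMiddle ℓ k < ℓ := by
  rw [ofMiddle]
  split_ifs <;> omega

theorem ofMiddle_toMiddle {ℓ c : ℕ} (h : c < ℓ) : ofMiddle ℓ (toMiddle ℓ c) = c := by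
  rw [ofMiddle, toMiddle]
  split_ifs <;> omega

theorem toMiddle_ofMiddle {ℓ k : ℕ} (h : k < ℓ) : toMiddle ℓ (ofMiddle ℓ k) = k := by
  rw [ofMiddle, toMiddle]
  split_ifs <;> omega

theorem mem_image_ofMiddle {ℓ c : ℕ} {S : Finset ℕ} :
    c ∈ (Finset.range ℓ \ S).image (ofMiddle ℓ) ↔ c < ℓ ∧ toMiddle ℓ c ∉ S := by
  simp only [Finset.mem_image, Finset.mem_sdiff, Finset.mem_range]
  constructor
  · rintro ⟨k, ⟨hk, hS⟩, rfl⟩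
    exact ⟨ofMiddle_lt hk, by rwa [toMiddle_ofMiddle hk]⟩
  · rintro ⟨hc, hS⟩
    exact ⟨_, ⟨toMiddle_lt hc, hS⟩, ofMiddle_toMiddle hc⟩

theorem mem_image_toMiddle {ℓ k : ℕ} {C : Finset ℕ} :
    k ∈ (Finset.range ℓ \ C).image (toMiddle ℓ) ↔ k < ℓ ∧ ofMiddle ℓ k ∉ C := by
  simp only [Finset.mem_image, Finset.mem_sdiff, Finset.mem_range]
  constructor
  · rintro ⟨c, ⟨hc, hC⟩, rfl⟩
    exact ⟨toMiddle_lt hc, by rwa [ofMiddle_toMiddle hc]⟩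
  · rintro ⟨hk, hC⟩
    exact ⟨_, ⟨ofMiddle_lt hk, hC⟩, toMiddle_ofMiddle hk⟩

theorem card_image_sdiff {ℓ : ℕ} {S : Finset ℕ} (hS : S ⊆ Finset.range ℓ) {f g : ℕ → ℕ}
    (hgf : ∀ k < ℓ, g (f k) = k) : ((Finset.range ℓ \ S).image f).card = ℓ - S.card := by
  rw [Finset.card_image_of_injOn, Finset.card_sdiff_of_subset hS, Finset.card_range]
  intro a ha b hb hab
  simp only [Finset.coe_sdiff, Finset.coe_range, Set.mem_sdiff, Set.mem_Iio] at ha hb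
  rw [← hgf a ha.1, ← hgf b hb.1, hab]

theorem mem_balancedBeads_image_ofMiddle {ℓ p : ℕ} {S : Finset ℕ} :
    p ∈ balancedBeads ℓ ((Finset.range ℓ \ S).image (ofMiddle ℓ)) ↔
      (p < ℓ ∧ ℓ - 1 - p ∉ S) ∨ (ℓ ≤ p ∧ p - ℓ < ℓ ∧ p - ℓ ∉ S) := by
  rw [balancedBeads, Finset.mem_union, Finset.mem_image, Finset.mem_image]
  simp only [mem_image_ofMiddle]
  constructor
  · rintro (⟨c, ⟨hc, hS⟩, rfl⟩ | ⟨c, ⟨hc, hS⟩, rfl⟩)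
    · rw [toMiddle] at hS
      split_ifs at hS with h
      · exact Or.inl ⟨h, hS⟩
      · exact Or.inr ⟨by omega, by omega, hS⟩
    · rw [toMiddle] at hS
      split_ifs at hS with h
      · exact Or.inr ⟨by omega, by omega, by
          rwa [show 2 * ℓ - 1 - 2 * c - ℓ = ℓ - 1 - 2 * c by omega]⟩
      · exact Or.inl ⟨by omega, by rwa [show ℓ - 1 - (2 * ℓ - 1 - 2 * c) = 2 * c - ℓ by omega]⟩
  · intro h
    rcases Nat.mod_two_eq_zero_or_one p with hp | hp
    · left
      refine ⟨p / 2, ⟨by omega, ?_⟩, by omega⟩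
      rw [toMiddle, show 2 * (p / 2) = p by omega]
      rcases h with ⟨h1, h2⟩ | ⟨h1, h2, h3⟩
      · rwa [if_pos h1]
      · rwa [if_neg (by omega)]
    · right
      refine ⟨(2 * ℓ - 1 - p) / 2, ⟨by omega, ?_⟩, by omega⟩
      rw [toMiddle, show 2 * ((2 * ℓ - 1 - p) / 2) = 2 * ℓ - 1 - p by omega]
      rcases h with ⟨h1, h2⟩ | ⟨h1, h2, h3⟩
      · rwa [if_neg (by omega), show 2 * ℓ - 1 - p - ℓ = ℓ - 1 - p by omega]
      · rwa [if_pos (by omega), show ℓ - 1 - (2 * ℓ - 1 - p) = p - ℓ by omega]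

theorem barQuot1_addOnes (ℓ : ℕ) (S : Finset ℕ) : barQuot1 (addOnes ℓ S) =
    ptnOfBeads (balancedBeads ℓ ((Finset.range ℓ \ S).image (ofMiddle ℓ))) := by
  have hs := strict_addOnes ℓ S
  have hN := hs.length_le_length_double
  rw [length_addOnes] at hN
  rw [barQuot1, quotP,
    ← ptnOfBeads_prependBeads ((double (addOnes ℓ S)).length - ℓ) (balancedBeads _ _)]
  congr 1
  ext s
  rw [mem_prependBeads, mem_balancedBeads_image_ofMiddle, runnerLevels, Finset.mem_filter]
  have hrange : 3 * s + 1 ∈ betaSet (double (addOnes ℓ S)) (3 * (double (addOnes ℓ S)).length) →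
      s ∈ Finset.range ((double (addOnes ℓ S)).part 0 +
        3 * (double (addOnes ℓ S)).length + 1) := by
    intro h
    obtain ⟨i, -, hi⟩ := Finset.mem_image.mp h
    have := (double (addOnes ℓ S)).part_anti (Nat.zero_le i)
    rw [Finset.mem_range]
    omega
  rw [and_iff_right_of_imp hrange, mem_betaSet_double hs (by omega)]
  generalize (double (addOnes ℓ S)).length = N at *
  by_cases hsN : s < N
  · rw [show 3 * N - (3 * s + 1) = 3 * (N - 1 - s) + 2 by omega, three_mul_add_two_mem_addOnes]
    by_cases hd : s < N - ℓ
    · exact iff_of_true (Or.inl ⟨by omega, by omega⟩) (Or.inl hd)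
    · rw [show ℓ - 1 - (s - (N - ℓ)) = N - 1 - s by omega]
      constructor
      · rintro (⟨-, h⟩ | ⟨h, -⟩)
        · exact Or.inr ⟨by omega, Or.inl ⟨by omega, fun hS => h ⟨by omega, hS⟩⟩⟩
        · omega
      · rintro (h | ⟨-, ⟨-, h⟩ | ⟨h, -⟩⟩)
        · omega
        · exact Or.inl ⟨by omega, fun hS => h hS.2⟩
        · omega
  · rw [show 3 * s + 1 - 3 * N = 3 * (s - N) + 1 by omega, three_mul_add_one_mem_addOnes,
      show s - (N - ℓ) - ℓ = s - N by omega]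
    constructor
    · rintro (⟨h, -⟩ | ⟨-, h⟩)
      · omega
      · exact Or.inr ⟨by omega, Or.inr ⟨by omega, h⟩⟩
    · rintro (h | ⟨-, ⟨h, -⟩ | ⟨-, h⟩⟩)
      · omega
      · omega
      · exact Or.inr ⟨by omega, h⟩

theorem rKey_two_union {n : ℕ} {f g : ℕ → ℕ} (hf : ∀ i j, i < j → j < n → f i < f j)
    (hf2 : ∀ i < n, f i % 2 = 0) (hg2 : ∀ i < n, g i % 2 = 1) {k : ℕ} (hk : k < n) :
    rKey 2 ((Finset.range n).image f ∪ (Finset.range n).image g) (f k) = 2 * k := by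
  have h : ((Finset.range n).image f ∪ (Finset.range n).image g).filter
      (fun q => q % 2 = f k % 2 ∧ q < f k) =
      ((Finset.range n).image f).filter (fun q => q < f k) := by
    ext q
    simp only [Finset.mem_filter, Finset.mem_union, Finset.mem_image, Finset.mem_range]
    have hfk := hf2 k hk
    constructor
    · rintro ⟨h | ⟨i, hi, rfl⟩, h1, h2⟩
      · exact ⟨h, h2⟩
      · have := hg2 i hi
        omega
    · rintro ⟨⟨i, hi, rfl⟩, h2⟩
      exact ⟨Or.inl ⟨i, hi, rfl⟩, by rw [hf2 i hi, hfk], h2⟩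
  rw [rKey, h, card_filter_lt_of_strictMonoOn hf hk, hf2 k hk, add_zero]

theorem rKey_two_union_odd {n : ℕ} {f g : ℕ → ℕ} (hg : ∀ i j, i < j → j < n → g i < g j)
    (hf2 : ∀ i < n, f i % 2 = 0) (hg2 : ∀ i < n, g i % 2 = 1) {k : ℕ} (hk : k < n) :
    rKey 2 ((Finset.range n).image f ∪ (Finset.range n).image g) (g k) = 2 * k + 1 := by
  have h : ((Finset.range n).image f ∪ (Finset.range n).image g).filter
      (fun q => q % 2 = g k % 2 ∧ q < g k) =
      ((Finset.range n).image g).filter (fun q => q < g k) := by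
    ext q
    simp only [Finset.mem_filter, Finset.mem_union, Finset.mem_image, Finset.mem_range]
    have hgk := hg2 k hk
    constructor
    · rintro ⟨⟨i, hi, rfl⟩ | h, h1, h2⟩
      · have := hf2 i hi
        omega
      · exact ⟨h, h2⟩
    · rintro ⟨⟨i, hi, rfl⟩, h2⟩
      exact ⟨Or.inr ⟨i, hi, rfl⟩, by rw [hg2 i hi, hgk], h2⟩
  rw [rKey, h, card_filter_lt_of_strictMonoOn hg hk, hg2 k hk]

theorem rSign_smul_schur_balancedBeads {n L : ℕ} {C : Finset ℕ} (hC : C ⊆ Finset.range L)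
    (hn : C.card = n) : ∃ c : Fin n → ℕ, Function.Injective c ∧ Finset.univ.image c = C ∧
      rSign 2 (ptnOfBeads (balancedBeads L C)) • schur (ptnOfBeads (balancedBeads L C)) =
        Matrix.det (Matrix.of (interleave
          (fun i => evenRow (n * 2) (c i)) (fun i => oddRow (n * 2) L (c i.rev)))) := by
  obtain ⟨f, hf, hfC⟩ := exists_enum C
  rw [hn] at hf hfC
  have hfL : ∀ i < n, f i < L := fun i hi => Finset.mem_range.mp
    (hC (hfC ▸ Finset.mem_image_of_mem f (Finset.mem_range.mpr hi)))
  have hB : balancedBeads L C = (Finset.range n).image (fun i => 2 * f i) ∪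
      (Finset.range n).image (fun i => 2 * L - 1 - 2 * f (n - 1 - i)) := by
    have hrev : (Finset.range n).image (fun i => n - 1 - i) = Finset.range n := by
      ext i
      simp only [Finset.mem_image, Finset.mem_range]
      constructor
      · rintro ⟨j, hj, rfl⟩
        omega
      · intro hi
        exact ⟨n - 1 - i, by omega, by omega⟩
    rw [balancedBeads, ← hfC, Finset.image_image, Finset.image_image]
    congr 1
    conv_lhs => rw [← hrev, Finset.image_image]
    rfl
  have he : ∀ i j, i < j → j < n → 2 * f i < 2 * f j := fun i j hij hj => by
    have := hf i j hij hj
    omega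
  have ho : ∀ i j, i < j → j < n →
      2 * L - 1 - 2 * f (n - 1 - i) < 2 * L - 1 - 2 * f (n - 1 - j) := fun i j hij hj => by
    have h1 := hf (n - 1 - j) (n - 1 - i) (by omega) (by omega)
    have h2 := hfL (n - 1 - i) (by omega)
    omega
  have he2 : ∀ i < n, 2 * f i % 2 = 0 := fun i _ => by omega
  have ho2 : ∀ i < n, (2 * L - 1 - 2 * f (n - 1 - i)) % 2 = 1 := fun i hi => by
    have h2 := hfL (n - 1 - i) (by omega)
    omega
  have hBcard : (balancedBeads L C).card = n * 2 := by
    rw [hB, Finset.card_union_of_disjoint, Finset.card_image_of_injOn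
      (injOn_of_strictMonoOn_range he), Finset.card_image_of_injOn
      (injOn_of_strictMonoOn_range ho), Finset.card_range]
    · omega
    · rw [Finset.disjoint_left]
      intro q hq hq'
      obtain ⟨i, hi, rfl⟩ := Finset.mem_image.mp hq
      obtain ⟨j, hj, h⟩ := Finset.mem_image.mp hq'
      have h1 := he2 i (Finset.mem_range.mp hi)
      have h2 := ho2 j (Finset.mem_range.mp hj)
      omega
  refine ⟨fun i => f i, fun i j hij => ?_, ?_, ?_⟩
  · exact Fin.ext (injOn_of_strictMonoOn_range hf (by simp) (by simp) hij)
  · rw [← hfC]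
    ext q
    simp only [Finset.mem_image, Finset.mem_univ, true_and, Finset.mem_range]
    exact ⟨fun ⟨i, h⟩ => ⟨i, i.2, h⟩, fun ⟨i, hi, h⟩ => ⟨⟨i, hi⟩, h⟩⟩
  · rw [rSign_smul_schur_ptnOfBeads hBcard (fun p => if p.val % 2 = 0 then 2 * f (p.val / 2)
      else 2 * L - 1 - 2 * f (n - 1 - p.val / 2))]
    · congr 1
      ext1 p j
      rw [Matrix.of_apply, Matrix.of_apply, interleave]
      split_ifs with hp
      · rfl
      · rw [oddRow]
        dsimp only
        rw [Fin.val_rev, Fin.coe_divNat, show n - (p.val / 2 + 1) = n - 1 - p.val / 2 by omega]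
    · intro p
      have hp : p.val / 2 < n := by omega
      rw [hB, Finset.mem_union]
      split_ifs
      · exact Or.inl (Finset.mem_image_of_mem (fun i => 2 * f i) (Finset.mem_range.mpr hp))
      · exact Or.inr (Finset.mem_image_of_mem (fun i => 2 * L - 1 - 2 * f (n - 1 - i))
          (Finset.mem_range.mpr hp))
    · intro p
      have hp : p.val / 2 < n := by omega
      rw [hB]
      split_ifs
      · rw [rKey_two_union he he2 ho2 hp]
        omega
      · rw [rKey_two_union_odd ho he2 ho2 hp]
        omega

/-- The intermediate identity in the proof of Theorem 6.1:
`Σ_{μ ∈ F_1^m(Λ_ℓ)} δ_2(μ^b[1]) S_{μ^b[1]} = p_2 ∘ S_{□(ℓ-m,m)}`. -/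
theorem stmt15 (ℓ m : ℕ) (hℓ : 1 ≤ ℓ) (hm : m ≤ ℓ) :
    ∑ᶠ μ ∈ F1Lam ℓ m, rSign 2 (barQuot1 μ) • schur (barQuot1 μ)
      = pleth 2 (schur (rect (ℓ - m) m)) := by
  rw [← sum_det_interleave_evenRow_oddRow (ℓ - m) m
    (fun C => rSign 2 (ptnOfBeads (balancedBeads ℓ C)) • schur (ptnOfBeads (balancedBeads ℓ C)))]
  · rw [F1Lam_eq_image, finsum_mem_image (injOn_addOnes ℓ m), finsum_mem_coe_finset,
      Nat.sub_add_cancel hm]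
    refine Finset.sum_nbij' (fun S => (Finset.range ℓ \ S).image (ofMiddle ℓ))
      (fun C => (Finset.range ℓ \ C).image (toMiddle ℓ)) ?_ ?_ ?_ ?_ ?_
    · intro S hS
      rw [Finset.mem_powersetCard] at hS ⊢
      refine ⟨fun c hc => Finset.mem_range.mpr (mem_image_ofMiddle.mp hc).1, ?_⟩
      rw [card_image_sdiff hS.1 (fun _ => toMiddle_ofMiddle), hS.2]
    · intro C hC
      rw [Finset.mem_powersetCard] at hC ⊢
      refine ⟨fun k hk => Finset.mem_range.mpr (mem_image_toMiddle.mp hk).1, ?_⟩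
      rw [card_image_sdiff hC.1 (fun _ => ofMiddle_toMiddle), hC.2]
      omega
    · intro S hS
      have hS := (Finset.mem_powersetCard.mp hS).1
      ext k
      rw [mem_image_toMiddle, mem_image_ofMiddle]
      constructor
      · rintro ⟨hk, h⟩
        rw [toMiddle_ofMiddle hk] at h
        by_contra hkS
        exact h ⟨ofMiddle_lt hk, hkS⟩
      · intro hk
        have hkℓ := Finset.mem_range.mp (hS hk)
        rw [toMiddle_ofMiddle hkℓ]
        exact ⟨hkℓ, fun h => h.2 hk⟩
    · intro C hC
      have hC := (Finset.mem_powersetCard.mp hC).1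
      ext c
      rw [mem_image_ofMiddle, mem_image_toMiddle]
      constructor
      · rintro ⟨hc, h⟩
        rw [ofMiddle_toMiddle hc] at h
        by_contra hcC
        exact h ⟨toMiddle_lt hc, hcC⟩
      · intro hc
        have hcℓ := Finset.mem_range.mp (hC hc)
        rw [ofMiddle_toMiddle hcℓ]
        exact ⟨hcℓ, fun h => h.2 hc⟩
    · intro S _
      rw [barQuot1_addOnes]
  · intro C hC
    rw [Nat.sub_add_cancel hm] at hC ⊢
    rw [Finset.mem_powersetCard] at hC
    exact rSign_smul_schur_balancedBeads hC.1 hC.2
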